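/- arXiv:1212.0865 — 6 statements merged into one kernel-verified Lean document; each statement's English description precedes it below -/
import Mathlib

section
/- Let L be an even unimodular lattice and σ an automorphism of prime order p with fixed sublattice L_K = L ∩ ker(σ−1) and L_I = L ∩ im(σ−1). Then the discriminant groups L_K^#/L_K and L_I^#/L_I are both isomorphic to (ℤ/pℤ)^s for some s ≥ 0. -/
open scoped RealInnerProductSpace

noncomputable section

abbrev Eu (n : ℕ) := EuclideanSpace ℝ (Fin n)

/-- The dual of a set of lattice vectors: all vectors pairing integrally with the set. -/
def dualSet {n : ℕ} (L : Set (Eu n)) : Set (Eu n) :=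
  {x | ∀ y ∈ L, ∃ k : ℤ, ⟪x, y⟫ = (k : ℝ)}

/-- A set of vectors is even if all norms are even integers. -/
def IsEvenLat {n : ℕ} (L : Set (Eu n)) : Prop :=
  ∀ x ∈ L, ∃ k : ℤ, ⟪x, x⟫ = 2 * (k : ℝ)

/-- σ is an automorphism of the lattice L: an orthogonal map preserving L. -/
def IsAutoOf {n : ℕ} (σ : Eu n ≃ₗ[ℝ] Eu n) (L : Submodule ℤ (Eu n)) : Prop :=
  (∀ x y : Eu n, ⟪σ x, σ y⟫ = ⟪x, y⟫) ∧ σ '' (L : Set (Eu n)) = (L : Set (Eu n))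

/-- The fixed space ker(σ - 1). -/
def fixSpace {n : ℕ} (σ : Eu n ≃ₗ[ℝ] Eu n) : Submodule ℝ (Eu n) :=
  LinearMap.ker (σ.toLinearMap - LinearMap.id)

/-- The image space im(σ - 1). -/
def imSpace {n : ℕ} (σ : Eu n ≃ₗ[ℝ] Eu n) : Submodule ℝ (Eu n) :=
  LinearMap.range (σ.toLinearMap - LinearMap.id)

/-- The intersection of a lattice with a rational subspace, as an additive subgroup. -/
def latIn {n : ℕ} (L : Submodule ℤ (Eu n)) (W : Submodule ℝ (Eu n)) : AddSubgroup (Eu n) :=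
  L.toAddSubgroup ⊓ W.toAddSubgroup

/-- The dual lattice of a set S taken inside the subspace W. -/
def dualIn {n : ℕ} (W : Submodule ℝ (Eu n)) (S : Set (Eu n)) : AddSubgroup (Eu n) where
  carrier := {x | x ∈ W ∧ ∀ y ∈ S, ∃ k : ℤ, ⟪x, y⟫ = (k : ℝ)}
  zero_mem' := ⟨W.zero_mem, fun y _ => ⟨0, by simp⟩⟩
  add_mem' := by
    rintro a b ⟨haW, ha⟩ ⟨hbW, hb⟩
    refine ⟨W.add_mem haW hbW, fun y hy => ?_⟩
    obtain ⟨k, hk⟩ := ha y hy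
    obtain ⟨l, hl⟩ := hb y hy
    exact ⟨k + l, by rw [inner_add_left, hk, hl]; push_cast; ring⟩
  neg_mem' := by
    rintro a ⟨haW, ha⟩
    refine ⟨W.neg_mem haW, fun y hy => ?_⟩
    obtain ⟨k, hk⟩ := ha y hy
    exact ⟨-k, by rw [inner_neg_left, hk]; push_cast; ring⟩

/-- A spanning set of vectors on which the inner product is integral generates a discrete
subgroup. -/
theorem discreteTopology_of_le_dualSet {n : ℕ} (L : Submodule ℤ (Eu n))
    (hfull : Submodule.span ℝ (L : Set (Eu n)) = ⊤)
    (hint : (L : Set (Eu n)) ⊆ dualSet (L : Set (Eu n))) : DiscreteTopology L := by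
  classical
  obtain ⟨s, hsL, hspan, hli⟩ := exists_linearIndependent ℝ (L : Set (Eu n))
  have : Finite s := hli.finite
  let b : Module.Basis s ℝ (Eu n) := Module.Basis.mk hli (by
    rw [Subtype.range_coe, hspan, hfull])
  have hnd : (innerₗ (Eu n) : LinearMap.BilinForm ℝ (Eu n)).Nondegenerate :=
    ⟨fun x hx => inner_self_eq_zero.mp (hx x), fun x hx => inner_self_eq_zero.mp (hx x)⟩
  have hle : (L : Set (Eu n)) ⊆ (Submodule.span ℤ
      (Set.range (LinearMap.BilinForm.dualBasis _ hnd b)) : Set (Eu n)) := by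
    rw [← LinearMap.BilinForm.dualSubmodule_span_of_basis]
    intro x hx
    rw [SetLike.mem_coe, LinearMap.BilinForm.mem_dualSubmodule]
    intro y hy
    have hyL : y ∈ L := by
      refine Submodule.span_le.mpr ?_ hy
      rintro _ ⟨i, rfl⟩
      rw [Module.Basis.mk_apply]
      exact hsL i.2
    obtain ⟨k, hk⟩ := hint hx y hyL
    rw [innerₗ_apply_apply, hk]
    exact Submodule.mem_one.mpr ⟨k, by simp⟩
  exact DiscreteTopology.of_subset
    (inferInstanceAs (DiscreteTopology (Submodule.span ℤ
      (Set.range (LinearMap.BilinForm.dualBasis _ hnd b))))) hle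

/-- If a real linear map `T` preserves a spanning lattice `L`, then `L ∩ range T` spans
`range T`. -/
theorem span_latIn_range {n : ℕ} (L : Submodule ℤ (Eu n))
    (hfull : Submodule.span ℝ (L : Set (Eu n)) = ⊤) (T : Eu n →ₗ[ℝ] Eu n)
    (hT : ∀ x ∈ L, T x ∈ L) :
    Submodule.span ℝ (latIn L (LinearMap.range T) : Set (Eu n)) = LinearMap.range T := by
  refine le_antisymm (Submodule.span_le.mpr fun x hx => hx.2) ?_
  have hmap : LinearMap.range T = Submodule.span ℝ (T '' (L : Set (Eu n))) := by
    rw [LinearMap.range_eq_map, ← hfull, Submodule.map_span]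
  refine hmap.le.trans (Submodule.span_mono ?_)
  rintro _ ⟨x, hx, rfl⟩
  exact ⟨hT x hx, LinearMap.mem_range_self T x⟩

/-- For a unimodular lattice, every element of the dual of `L ∩ W` is the orthogonal projection
of an element of `L`. -/
theorem exists_starProjection_eq {n : ℕ} (L : Submodule ℤ (Eu n))
    (hfull : Submodule.span ℝ (L : Set (Eu n)) = ⊤)
    (huni : dualSet (L : Set (Eu n)) = (L : Set (Eu n))) (W : Submodule ℝ (Eu n))
    (hW : Submodule.span ℝ (latIn L W : Set (Eu n)) = W) (x : Eu n)
    (hx : x ∈ dualIn W (latIn L W : Set (Eu n))) : ∃ z ∈ L, W.starProjection z = x := by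
  have : DiscreteTopology L := discreteTopology_of_le_dualSet L hfull huni.ge
  have : IsZLattice ℝ L := ⟨hfull⟩
  have : Module.Finite ℤ L := ZLattice.module_finite ℝ L
  have : Module.Free ℤ L := ZLattice.module_free ℝ L
  let LW : Submodule ℤ L := (W.restrictScalars ℤ).comap L.subtype
  have : Module.IsTorsionFree ℤ (L ⧸ LW) := by
    refine Module.isTorsionFree_iff_smul_eq_zero.mpr fun {k} a hka => ?_
    obtain ⟨y, rfl⟩ := LW.mkQ_surjective a
    rw [← map_smul, ← LinearMap.mem_ker, Submodule.ker_mkQ] at hka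
    refine or_iff_not_imp_left.mpr fun hk => ?_
    rw [← LinearMap.mem_ker, Submodule.ker_mkQ]
    refine (W.smul_mem_iff (Int.cast_ne_zero.mpr hk : (k : ℝ) ≠ 0)).mp ?_
    rw [Int.cast_smul_eq_zsmul]
    exact hka
  obtain ⟨s, hs⟩ := Module.projective_lifting_property LW.mkQ LinearMap.id LW.mkQ_surjective
  have hsub (y : L) : y - s (LW.mkQ y) ∈ LW := by
    refine (Submodule.Quotient.eq LW).mp ?_
    exact (LinearMap.congr_fun hs (LW.mkQ y)).symm
  let F : L →ₗ[ℤ] ℝ := ((innerₗ (Eu n) x).restrictScalars ℤ) ∘ₗ L.subtype ∘ₗ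
    (LinearMap.id - s ∘ₗ LW.mkQ)
  have hF (y : L) : F y = ⟪x, ((y - s (LW.mkQ y) : L) : Eu n)⟫ := rfl
  let bZ := Module.Free.chooseBasis ℤ L
  let G : Eu n →ₗ[ℝ] ℝ := (bZ.ofZLatticeBasis ℝ L).constr ℝ (fun i => F (bZ i))
  have hG (y : L) : G y = F y := by
    have : (G.restrictScalars ℤ) ∘ₗ L.subtype = F := by
      refine bZ.ext fun i => ?_
      have h := (bZ.ofZLatticeBasis ℝ L).constr_basis ℝ (fun i => F (bZ i)) i
      rwa [bZ.ofZLatticeBasis_apply ℝ L] at h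
    exact LinearMap.congr_fun this y
  let z : Eu n := (InnerProductSpace.toDual ℝ (Eu n)).symm (LinearMap.toContinuousLinearMap G)
  have hz (y : Eu n) : ⟪z, y⟫ = G y := by
    simp [z, InnerProductSpace.toDual_symm_apply]
  refine ⟨z, ?_, ?_⟩
  · rw [← SetLike.mem_coe, ← huni]
    intro y hy
    obtain ⟨k, hk⟩ := hx.2 _ ⟨((⟨y, hy⟩ : L) - s (LW.mkQ ⟨y, hy⟩)).2, hsub ⟨y, hy⟩⟩
    exact ⟨k, by rw [hz, hG ⟨y, hy⟩, hF, hk]⟩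
  · refine Submodule.eq_starProjection_of_mem_orthogonal hx.1 ?_
    have hle : W ≤ (Submodule.span ℝ {z - x})ᗮ := by
      rw [← hW]
      refine Submodule.span_le.mpr fun y hy => ?_
      rw [SetLike.mem_coe, Submodule.mem_orthogonal_singleton_iff_inner_right, inner_sub_left,
        hz, hG ⟨y, hy.1⟩, hF]
      have h0 : LW.mkQ ⟨y, hy.1⟩ = 0 := by
        rw [← LinearMap.mem_ker, Submodule.ker_mkQ]
        exact hy.2
      rw [h0, map_zero, sub_zero, sub_self]
    rw [Submodule.mem_orthogonal']
    intro y hy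
    exact Submodule.mem_orthogonal_singleton_iff_inner_right.mp (hle hy)

/-- The vectors of `L` whose orthogonal projection to `W` lies in `L`. -/
def projGlue {n : ℕ} (L : Submodule ℤ (Eu n)) (W : Submodule ℝ (Eu n)) : AddSubgroup L :=
  L.toAddSubgroup.comap
    ((W.starProjection : Eu n →ₗ[ℝ] Eu n).toAddMonoidHom.comp L.toAddSubgroup.subtype)

theorem mem_projGlue {n : ℕ} {L : Submodule ℤ (Eu n)} {W : Submodule ℝ (Eu n)} {x : L} :
    x ∈ projGlue L W ↔ W.starProjection (x : Eu n) ∈ L := Iff.rfl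

theorem projGlue_orthogonal {n : ℕ} (L : Submodule ℤ (Eu n)) (W : Submodule ℝ (Eu n)) :
    projGlue L Wᗮ = projGlue L W := by
  ext x
  have h := W.starProjection_add_starProjection_orthogonal (x : Eu n)
  rw [mem_projGlue, mem_projGlue]
  constructor
  · intro hx
    rw [← add_sub_cancel_right (W.starProjection (x : Eu n)) (Wᗮ.starProjection (x : Eu n)), h]
    exact L.sub_mem x.2 hx
  · intro hx
    rw [← add_sub_cancel_left (W.starProjection (x : Eu n)) (Wᗮ.starProjection (x : Eu n)), h]
    exact L.sub_mem x.2 hx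

/-- For a unimodular lattice, the discriminant group of `L ∩ W` is `L` modulo the vectors
whose projection to `W` lies in `L`. -/
theorem nonempty_discriminant_equiv {n : ℕ} (L : Submodule ℤ (Eu n))
    (hfull : Submodule.span ℝ (L : Set (Eu n)) = ⊤)
    (huni : dualSet (L : Set (Eu n)) = (L : Set (Eu n))) (W : Submodule ℝ (Eu n))
    (hW : Submodule.span ℝ (latIn L W : Set (Eu n)) = W) :
    Nonempty ((dualIn W (latIn L W : Set (Eu n)) ⧸
      (latIn L W).addSubgroupOf (dualIn W (latIn L W : Set (Eu n)))) ≃+ (L ⧸ projGlue L W)) := by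
  let f : L →+ dualIn W (latIn L W : Set (Eu n)) :=
    AddMonoidHom.codRestrict
      ((W.starProjection : Eu n →ₗ[ℝ] Eu n).toAddMonoidHom.comp L.toAddSubgroup.subtype) _ (by
        intro x
        refine ⟨W.starProjection_apply_mem _, fun y hy => ?_⟩
        obtain ⟨k, hk⟩ := huni.ge x.2 y hy.1
        refine ⟨k, ?_⟩
        rw [← hk]
        change ⟪W.starProjection (x : Eu n), y⟫ = _
        rw [Submodule.inner_starProjection_left_eq_right,
          Submodule.starProjection_eq_self_iff.mpr hy.2])
  have hf (x : L) : (f x : Eu n) = W.starProjection (x : Eu n) := rfl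
  let N := (latIn L W).addSubgroupOf (dualIn W (latIn L W : Set (Eu n)))
  let g := (QuotientAddGroup.mk' N).comp f
  have hg : Function.Surjective g := by
    refine (QuotientAddGroup.mk'_surjective N).comp fun x => ?_
    obtain ⟨z, hz, hzx⟩ := exists_starProjection_eq L hfull huni W hW x x.2
    exact ⟨⟨z, hz⟩, Subtype.ext hzx⟩
  have hker : g.ker = projGlue L W := by
    ext x
    rw [AddMonoidHom.mem_ker, mem_projGlue, AddMonoidHom.comp_apply, QuotientAddGroup.mk'_apply,
      QuotientAddGroup.eq_zero_iff, AddSubgroup.mem_addSubgroupOf, hf]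
    exact ⟨fun h => h.1, fun h => ⟨h, W.starProjection_apply_mem _⟩⟩
  exact ⟨((QuotientAddGroup.quotientAddEquivOfEq hker.symm).trans
    (QuotientAddGroup.quotientKerEquivOfSurjective g hg)).symm⟩

/-- A finitely generated abelian group killed by a prime `p` is a power of `ℤ/pℤ`. -/
theorem exists_equiv_zmod_pow {A : Type*} [AddCommGroup A] [Module.Finite ℤ A] (p : ℕ)
    (hp : p.Prime) (hA : ∀ a : A, p • a = 0) :
    ∃ s : ℕ, Nonempty (A ≃+ (Fin s → ZMod p)) := by
  have : Fact p.Prime := ⟨hp⟩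
  let inst : Module (ZMod p) A := AddCommGroup.zmodModule hA
  have : Module.Finite (ZMod p) A := Module.Finite.of_restrictScalars_finite ℤ (ZMod p) A
  clear_value inst
  exact ⟨_, ⟨(Module.finBasis (ZMod p) A).equivFun.toAddEquiv⟩⟩

/-- The sum `1 + σ + ⋯ + σ ^ (p - 1)`. -/
def normMap {n : ℕ} (σ : Eu n ≃ₗ[ℝ] Eu n) (p : ℕ) : Eu n →ₗ[ℝ] Eu n :=
  ∑ i ∈ Finset.range p, σ.toLinearMap ^ i

section NormMap

variable {n : ℕ} {σ : Eu n ≃ₗ[ℝ] Eu n} {p : ℕ}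

theorem normMap_mem_fixSpace (h : σ ^ p = 1) (x : Eu n) : normMap σ p x ∈ fixSpace σ := by
  have hp : σ.toLinearMap ^ p = 1 := by
    exact (map_pow (LinearEquiv.automorphismGroup.toLinearMapMonoidHom) σ p).symm.trans
      (by rw [h, map_one])
  have : (σ.toLinearMap - 1) * normMap σ p = 0 := by
    rw [normMap, mul_geom_sum, hp, sub_self]
  exact LinearMap.congr_fun this x

theorem normMap_of_mem_fixSpace {x : Eu n} (hx : x ∈ fixSpace σ) : normMap σ p x = (p : ℝ) • x := by
  have hx : σ.toLinearMap x = x := sub_eq_zero.mp hx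
  have hi (i : ℕ) : (σ.toLinearMap ^ i) x = x := by
    rw [Module.End.pow_apply]
    exact Function.iterate_fixed hx i
  simp [normMap, LinearMap.sum_apply, hi, Nat.cast_smul_eq_nsmul]

theorem smul_sub_normMap_mem_imSpace (x : Eu n) :
    (p : ℝ) • x - normMap σ p x ∈ imSpace σ := by
  have h : (p : ℝ) • x - normMap σ p x = ∑ i ∈ Finset.range p, (x - (σ.toLinearMap ^ i) x) := by
    simp [normMap, LinearMap.sum_apply, Nat.cast_smul_eq_nsmul]
  rw [h]
  refine Submodule.sum_mem _ fun i _ => ?_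
  rw [← neg_sub]
  refine Submodule.neg_mem _ ⟨(∑ j ∈ Finset.range i, σ.toLinearMap ^ j) x, ?_⟩
  exact LinearMap.congr_fun (mul_geom_sum σ.toLinearMap i) x

theorem fixSpace_eq_range_normMap (hp : p ≠ 0) (h : σ ^ p = 1) :
    fixSpace σ = LinearMap.range (normMap σ p) := by
  refine le_antisymm ?_ ?_
  · intro x hx
    refine ⟨(p : ℝ)⁻¹ • x, ?_⟩
    rw [map_smul, normMap_of_mem_fixSpace hx, inv_smul_smul₀ (Nat.cast_ne_zero.mpr hp)]
  · rintro _ ⟨x, rfl⟩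
    exact normMap_mem_fixSpace h x

theorem imSpace_le_orthogonal_fixSpace (hσ : ∀ x y : Eu n, ⟪σ x, σ y⟫ = ⟪x, y⟫) :
    imSpace σ ≤ (fixSpace σ)ᗮ := by
  rintro _ ⟨w, rfl⟩ v hv
  have hv : σ v = v := sub_eq_zero.mp hv
  change ⟪v, σ w - w⟫ = 0
  rw [inner_sub_right, sub_eq_zero, ← hσ v w, hv]

theorem imSpace_eq_orthogonal_fixSpace (hσ : ∀ x y : Eu n, ⟪σ x, σ y⟫ = ⟪x, y⟫) (hp : p ≠ 0)
    (h : σ ^ p = 1) : imSpace σ = (fixSpace σ)ᗮ := by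
  refine le_antisymm (imSpace_le_orthogonal_fixSpace hσ) fun x hx => ?_
  have hsub := smul_sub_normMap_mem_imSpace (σ := σ) (p := p) x
  have hN : normMap σ p x ∈ (fixSpace σ)ᗮ := by
    rw [← sub_sub_cancel ((p : ℝ) • x) (normMap σ p x)]
    exact Submodule.sub_mem _ (Submodule.smul_mem _ _ hx) (imSpace_le_orthogonal_fixSpace hσ hsub)
  have h0 : normMap σ p x = 0 :=
    inner_self_eq_zero.mp (hN _ (normMap_mem_fixSpace h x))
  rw [h0, sub_zero] at hsub
  exact (Submodule.smul_mem_iff _ (Nat.cast_ne_zero.mpr hp)).mp hsub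

theorem starProjection_fixSpace_smul (hσ : ∀ x y : Eu n, ⟪σ x, σ y⟫ = ⟪x, y⟫) (h : σ ^ p = 1)
    (x : Eu n) : (fixSpace σ).starProjection ((p : ℝ) • x) = normMap σ p x :=
  Submodule.eq_starProjection_of_mem_orthogonal (normMap_mem_fixSpace h x)
    (imSpace_le_orthogonal_fixSpace hσ (smul_sub_normMap_mem_imSpace x))

theorem normMap_mem {L : Submodule ℤ (Eu n)} (hL : ∀ x ∈ L, σ x ∈ L) {x : Eu n} (hx : x ∈ L) :
    normMap σ p x ∈ L := by
  rw [normMap, LinearMap.sum_apply]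
  refine Submodule.sum_mem _ fun i hi => ?_
  clear hi
  induction i with
  | zero => exact hx
  | succ i ih =>
    rw [pow_succ']
    exact hL _ ih

end NormMap

/-- For an even unimodular lattice `L` and an automorphism `σ` of prime
order `p`, the discriminant groups of `L_K = L ∩ ker(σ-1)` and `L_I = L ∩ im(σ-1)`
are both isomorphic to `(ℤ/pℤ)^s` for some `s ≥ 0`. -/
theorem stmt1 {n : ℕ} (p : ℕ) (hp : p.Prime)
    (L : Submodule ℤ (Eu n)) (hfull : Submodule.span ℝ (L : Set (Eu n)) = ⊤)
    (hev : IsEvenLat (L : Set (Eu n))) (huni : dualSet (L : Set (Eu n)) = (L : Set (Eu n)))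
    (σ : Eu n ≃ₗ[ℝ] Eu n) (hσ : IsAutoOf σ L) (hord : orderOf σ = p) :
    ∃ s : ℕ,
      (Nonempty
        ((dualIn (Submodule.span ℝ ((latIn L (fixSpace σ)) : Set (Eu n)))
            ((latIn L (fixSpace σ)) : Set (Eu n)) ⧸
          (latIn L (fixSpace σ)).addSubgroupOf
            (dualIn (Submodule.span ℝ ((latIn L (fixSpace σ)) : Set (Eu n)))
              ((latIn L (fixSpace σ)) : Set (Eu n)))) ≃+ (Fin s → ZMod p))) ∧
      (Nonempty
        ((dualIn (Submodule.span ℝ ((latIn L (imSpace σ)) : Set (Eu n)))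
            ((latIn L (imSpace σ)) : Set (Eu n)) ⧸
          (latIn L (imSpace σ)).addSubgroupOf
            (dualIn (Submodule.span ℝ ((latIn L (imSpace σ)) : Set (Eu n)))
              ((latIn L (imSpace σ)) : Set (Eu n)))) ≃+ (Fin s → ZMod p))) := by
  obtain ⟨hinv, himg⟩ := hσ
  have hpow : σ ^ p = 1 := hord ▸ pow_orderOf_eq_one σ
  have hL (x : Eu n) (hx : x ∈ L) : σ x ∈ L := himg.le ⟨x, hx, rfl⟩
  have hK : Submodule.span ℝ (latIn L (fixSpace σ) : Set (Eu n)) = fixSpace σ := by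
    rw [fixSpace_eq_range_normMap hp.ne_zero hpow]
    exact span_latIn_range L hfull _ fun x hx => normMap_mem hL hx
  have hI : Submodule.span ℝ (latIn L (imSpace σ) : Set (Eu n)) = imSpace σ :=
    span_latIn_range L hfull _ fun x hx => L.sub_mem (hL x hx) hx
  obtain ⟨eK⟩ := nonempty_discriminant_equiv L hfull huni _ hK
  obtain ⟨eI⟩ := nonempty_discriminant_equiv L hfull huni _ hI
  have hglue : projGlue L (imSpace σ) = projGlue L (fixSpace σ) := by
    rw [imSpace_eq_orthogonal_fixSpace hinv hp.ne_zero hpow, projGlue_orthogonal]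
  have : DiscreteTopology L := discreteTopology_of_le_dualSet L hfull huni.ge
  have : IsZLattice ℝ L := ⟨hfull⟩
  have : Module.Finite ℤ L := ZLattice.module_finite ℝ L
  have : Module.Finite ℤ (L ⧸ projGlue L (fixSpace σ)) :=
    Module.Finite.of_surjective (QuotientAddGroup.mk' (projGlue L (fixSpace σ))).toIntLinearMap
      (QuotientAddGroup.mk'_surjective _)
  obtain ⟨s, ⟨e⟩⟩ := exists_equiv_zmod_pow (A := L ⧸ projGlue L (fixSpace σ)) p hp (by
    intro a
    obtain ⟨x, rfl⟩ := QuotientAddGroup.mk_surjective a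
    rw [← QuotientAddGroup.mk_nsmul, QuotientAddGroup.eq_zero_iff, mem_projGlue]
    have h : ((p • x : L) : Eu n) = (p : ℝ) • (x : Eu n) := by
      rw [Nat.cast_smul_eq_nsmul]
      rfl
    rw [h, starProjection_fixSpace_smul hinv hpow]
    exact normMap_mem hL x.2)
  rw [hK, hI]
  exact ⟨s, ⟨eK.trans e⟩, ⟨(eI.trans (QuotientAddGroup.quotientAddEquivOfEq hglue)).trans e⟩⟩
end
end

section
/- Let L be an even unimodular lattice with an automorphism σ of prime order p, and let π_K = (1/p)(1 + σ + ... + σ^{p−1}) be the orthogonal projection onto the fixed space. Then (1−σ) maps the dual lattice of L_I = L ∩ im(σ−1) into L_I; equivalently, (1−σ)π_I(L) ⊆ L ∩ im(σ−1), where π_I = 1 − π_K. -/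
open scoped RealInnerProductSpace

noncomputable section

/-- With `π_K = (1/p)(1 + σ + ⋯ + σ^{p-1})` and `π_I = 1 - π_K`,
the map `1 - σ` sends `π_I(L)` (which is the dual lattice of `L_I`) into
`L_I = L ∩ im(σ-1)`. -/
theorem stmt2 {n : ℕ} (p : ℕ) (hp : p.Prime)
    (L : Submodule ℤ (Eu n)) (hfull : Submodule.span ℝ (L : Set (Eu n)) = ⊤)
    (hev : IsEvenLat (L : Set (Eu n))) (huni : dualSet (L : Set (Eu n)) = (L : Set (Eu n)))
    (σ : Eu n ≃ₗ[ℝ] Eu n) (hσ : IsAutoOf σ L) (hord : orderOf σ = p)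
    (πK πI : Module.End ℝ (Eu n))
    (hπK : πK = (p : ℝ)⁻¹ • (∑ i ∈ Finset.range p, (σ.toLinearMap : Module.End ℝ (Eu n)) ^ i))
    (hπI : πI = 1 - πK) :
    ∀ x ∈ L, (1 - (σ.toLinearMap : Module.End ℝ (Eu n))) (πI x) ∈ latIn L (imSpace σ) := by
  intro x hx
  have hpow : (σ.toLinearMap : Module.End ℝ (Eu n)) ^ p = 1 := by
    have h : σ ^ p = 1 := hord ▸ pow_orderOf_eq_one σ
    have h' := congrArg (LinearEquiv.automorphismGroup.toLinearMapMonoidHom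
      (R := ℝ) (M := Eu n)) h
    rw [map_pow, map_one] at h'
    exact h'
  have hann : (1 - (σ.toLinearMap : Module.End ℝ (Eu n))) * πI = 1 - σ.toLinearMap := by
    rw [hπI, hπK, mul_sub, mul_one, mul_smul_comm, mul_neg_geom_sum, hpow, sub_self, smul_zero,
      sub_zero]
  have hval : (1 - (σ.toLinearMap : Module.End ℝ (Eu n))) (πI x) = x - σ x :=
    LinearMap.congr_fun hann x
  have hσx : σ x ∈ L := by
    have h : σ x ∈ σ '' (L : Set (Eu n)) := ⟨x, hx, rfl⟩
    rwa [hσ.2] at h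
  rw [hval]
  exact ⟨L.sub_mem hx hσx, -x, by simp [sub_eq_add_neg, add_comm]⟩
end
end

section
/- Let M be an even lattice (positive definite integral ℤ-lattice with all norms even) such that the discriminant group M^#/M has exponent 2. Then M contains a sublattice isometric to √2·U, where U is a unimodular lattice of the same rank as M. -/
open scoped RealInnerProductSpace

noncomputable section

/-- A set of lattice vectors is doubly integral if all inner products are even integers. -/
def IsDoublyIntegral {n : ℕ} (L : Set (Eu n)) : Prop :=
  ∀ x ∈ L, ∀ y ∈ L, ∃ k : ℤ, ⟪x, y⟫ = 2 * (k : ℝ)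

lemma discreteTopology_of_isEvenLat {n : ℕ} {M : Submodule ℤ (Eu n)}
    (hev : IsEvenLat (M : Set (Eu n))) : DiscreteTopology M := by
  refine DiscreteTopology.of_forall_le_norm (r := 1) one_pos fun x hx => ?_
  obtain ⟨k, hk⟩ := hev x x.2
  have hpos : 0 < ⟪(x : Eu n), (x : Eu n)⟫ :=
    real_inner_self_pos.2 (by simpa using hx)
  have hk_pos : (0 : ℤ) < k := by
    rw [hk] at hpos
    exact_mod_cast (by linarith : (0 : ℝ) < k)
  have hk_one : (1 : ℝ) ≤ k := by exact_mod_cast hk_pos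
  rw [real_inner_self_eq_norm_sq] at hk
  change 1 ≤ ‖(x : Eu n)‖
  nlinarith [norm_nonneg (x : Eu n)]

lemma mem_of_mem_dualSet_dualSet {n : ℕ} {M : Submodule ℤ (Eu n)} [DiscreteTopology M]
    (hfull : Submodule.span ℝ (M : Set (Eu n)) = ⊤) {x : Eu n}
    (hx : x ∈ dualSet (dualSet (M : Set (Eu n)))) : x ∈ M := by
  have : IsZLattice ℝ M := ⟨hfull⟩
  have : Module.Finite ℤ M := ZLattice.module_finite ℝ M
  have : Module.Free ℤ M := ZLattice.module_free ℝ M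
  let b := (Module.Free.chooseBasis ℤ M).ofZLatticeBasis ℝ
  have hb : Submodule.span ℤ (Set.range b) = M :=
    (Module.Free.chooseBasis ℤ M).ofZLatticeBasis_span ℝ
  let B : LinearMap.BilinForm ℝ (Eu n) := innerₗ (Eu n)
  have hsymm : B.IsSymm := ⟨fun x y => real_inner_comm y x⟩
  have hB : B.Nondegenerate :=
    ⟨fun x h => inner_self_eq_zero.1 (h x), fun x h => inner_self_eq_zero.1 (h x)⟩
  rw [← hb, ← LinearMap.BilinForm.dualSubmodule_dualSubmodule_of_basis B hB hsymm b, hb]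
  intro y hy
  obtain ⟨k, hk⟩ := hx y fun z hz => by
    obtain ⟨k, hk⟩ := Submodule.mem_one.1 (hy z hz)
    exact ⟨k, hk.symm⟩
  exact Submodule.mem_one.2 ⟨k, hk.symm⟩

lemma exists_maximal_isDoublyIntegral {n : ℕ} (M : Submodule ℤ (Eu n)) :
    ∃ N : Submodule ℤ (Eu n),
      Maximal (fun N => N ≤ M ∧ IsDoublyIntegral (N : Set (Eu n))) N := by
  have hbot : IsDoublyIntegral ((⊥ : Submodule ℤ (Eu n)) : Set (Eu n)) := by
    rintro x hx y -
    have hx : x = 0 := hx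
    exact ⟨0, by simp [hx]⟩
  obtain ⟨N, -, hN⟩ := zorn_le_nonempty₀
    {N : Submodule ℤ (Eu n) | N ≤ M ∧ IsDoublyIntegral (N : Set (Eu n))} (fun c hc hchain a ha => by
      refine ⟨sSup c, ⟨sSup_le fun N hN => (hc hN).1, fun x hx y hy => ?_⟩,
        fun N hN => le_sSup hN⟩
      obtain ⟨N₁, h₁, hx⟩ := (Submodule.mem_sSup_of_directed ⟨a, ha⟩ hchain.directedOn).1 hx
      obtain ⟨N₂, h₂, hy⟩ := (Submodule.mem_sSup_of_directed ⟨a, ha⟩ hchain.directedOn).1 hy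
      obtain ⟨N, hN, h₁N, h₂N⟩ := hchain.directedOn N₁ h₁ N₂ h₂
      exact (hc hN).2 x (h₁N hx) y (h₂N hy)) ⊥ ⟨bot_le, hbot⟩
  exact ⟨N, hN⟩

lemma mem_of_maximal_isDoublyIntegral {n : ℕ} {M N : Submodule ℤ (Eu n)}
    (hev : IsEvenLat (M : Set (Eu n)))
    (hN : Maximal (fun N : Submodule ℤ (Eu n) => N ≤ M ∧ IsDoublyIntegral (N : Set (Eu n))) N)
    {x : Eu n} (hx : x ∈ M) (hxN : ∀ y ∈ N, ∃ k : ℤ, ⟪x, y⟫ = 2 * (k : ℝ)) : x ∈ N := by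
  have hle : N ⊔ Submodule.span ℤ {x} ≤ N := by
    refine hN.2 ⟨sup_le hN.1.1 (by simpa using hx), ?_⟩ le_sup_left
    rintro u hu v hv
    obtain ⟨y, hy, s, hs, rfl⟩ := Submodule.mem_sup.1 hu
    obtain ⟨z, hz, t, ht, rfl⟩ := Submodule.mem_sup.1 hv
    obtain ⟨a, rfl⟩ := Submodule.mem_span_singleton.1 hs
    obtain ⟨b, rfl⟩ := Submodule.mem_span_singleton.1 ht
    obtain ⟨k₁, h₁⟩ := hN.1.2 y hy z hz
    obtain ⟨k₂, h₂⟩ := hxN y hy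
    obtain ⟨k₃, h₃⟩ := hxN z hz
    obtain ⟨k₄, h₄⟩ := hev x hx
    refine ⟨k₁ + b * k₂ + a * k₃ + a * b * k₄, ?_⟩
    simp only [← Int.cast_smul_eq_zsmul ℝ, inner_add_left, inner_add_right, real_inner_smul_left,
      real_inner_smul_right, real_inner_comm x y, h₁, h₂, h₃, h₄]
    push_cast
    ring
  exact hle (Submodule.mem_sup_right (Submodule.mem_span_singleton_self x))

/-- An even (full-rank, integral) lattice `M` whose discriminant group
`M^#/M` has exponent 2 (i.e. `2·M^# ⊆ M`) contains a sublattice isometric to `√2·U`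
for some unimodular lattice `U` of the same rank. -/
theorem stmt4 {n : ℕ} (M : Submodule ℤ (Eu n))
    (hfull : Submodule.span ℝ (M : Set (Eu n)) = ⊤)
    (hint : ∀ x ∈ M, ∀ y ∈ M, ∃ k : ℤ, ⟪x, y⟫ = (k : ℝ))
    (hev : IsEvenLat (M : Set (Eu n)))
    (hexp : ∀ x ∈ dualSet (M : Set (Eu n)), (2 : ℝ) • x ∈ M) :
    ∃ U : Submodule ℤ (Eu n),
      dualSet (U : Set (Eu n)) = (U : Set (Eu n)) ∧
      Submodule.span ℝ (U : Set (Eu n)) = ⊤ ∧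
      ∃ f : Eu n →ₗ[ℝ] Eu n,
        (∀ x y : Eu n, ⟪f x, f y⟫ = 2 * ⟪x, y⟫) ∧
        f '' (U : Set (Eu n)) ⊆ (M : Set (Eu n)) := by
  have := discreteTopology_of_isEvenLat hev
  obtain ⟨N, hN⟩ := exists_maximal_isDoublyIntegral M
  have hdual : ∀ w ∈ dualSet (M : Set (Eu n)), (2 : ℝ) • w ∈ N := fun w hw =>
    mem_of_maximal_isDoublyIntegral hev hN (hexp w hw) fun y hy => by
      obtain ⟨k, hk⟩ := hw y (hN.1.1 hy)
      exact ⟨k, by rw [real_inner_smul_left, hk]⟩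
  have hsq : √2 * √2 = (2 : ℝ) := Real.mul_self_sqrt (by norm_num)
  have hsq_ne : √2 ≠ (0 : ℝ) := by positivity
  let f : Eu n →ₗ[ℝ] Eu n := √2 • LinearMap.id
  have hf : ∀ x y : Eu n, ⟪f x, f y⟫ = 2 * ⟪x, y⟫ := fun x y => by
    change ⟪√2 • x, √2 • y⟫ = _
    rw [real_inner_smul_left, real_inner_smul_right, ← mul_assoc, hsq]
  have hf_surj : ∀ z : Eu n, ∃ y, f y = z := fun z => ⟨(√2)⁻¹ • z, smul_inv_smul₀ hsq_ne z⟩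
  have hU_dual : ∀ x : Eu n, (∀ y, f y ∈ N → ∃ k : ℤ, ⟪x, y⟫ = (k : ℝ)) → f x ∈ N := by
    intro x hx
    have heven : ∀ z ∈ N, ∃ k : ℤ, ⟪f x, z⟫ = 2 * (k : ℝ) := by
      intro z hz
      obtain ⟨y, rfl⟩ := hf_surj z
      obtain ⟨k, hk⟩ := hx y hz
      exact ⟨k, by rw [hf, hk]⟩
    refine mem_of_maximal_isDoublyIntegral hev hN
      (mem_of_mem_dualSet_dualSet hfull fun w hw => ?_) heven
    obtain ⟨k, hk⟩ := heven _ (hdual w hw)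
    rw [real_inner_smul_right] at hk
    exact ⟨k, by linarith⟩
  refine ⟨N.comap (f.restrictScalars ℤ), ?_, ?_, f, hf, ?_⟩
  · refine Set.Subset.antisymm (fun x hx => hU_dual x hx) fun x hx y hy => ?_
    obtain ⟨k, hk⟩ := hN.1.2 _ hx _ hy
    exact ⟨k, by linarith [hf x y, show ⟪f x, f y⟫ = 2 * (k : ℝ) from hk]⟩
  · rw [eq_top_iff, ← hfull, Submodule.span_le]
    intro x hx
    have hmem : √2 • x ∈ N.comap (f.restrictScalars ℤ) := by
      change √2 • √2 • x ∈ N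
      rw [smul_smul, hsq]
      exact hdual x fun y hy => hint x hx y hy
    rw [← inv_smul_smul₀ hsq_ne x]
    exact Submodule.smul_mem _ _ (Submodule.subset_span hmem)
  · rintro _ ⟨x, hx, rfl⟩
    exact hN.1.1 hx
end
end

section
/- Let L be an extremal even unimodular lattice of dimension 48 (i.e. min(L) = 6) and let σ ∈ Aut(L) have order 47. Then the fixed lattice L ∩ ker(σ−1) is 2-dimensional with Gram matrix [[6,1],[1,8]], and in particular has determinant 47. -/
open scoped RealInnerProductSpace

noncomputable section

/-- An extremal even unimodular lattice of dimension 48: even, unimodular, full rank,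
with minimum norm 6. -/
def IsExtremal48 (L : Submodule ℤ (Eu 48)) : Prop :=
  Submodule.span ℝ (L : Set (Eu 48)) = ⊤ ∧
  IsEvenLat (L : Set (Eu 48)) ∧
  dualSet (L : Set (Eu 48)) = (L : Set (Eu 48)) ∧
  (∀ x ∈ L, x ≠ 0 → 6 ≤ ⟪x, x⟫) ∧
  (∃ x ∈ L, ⟪x, x⟫ = (6 : ℝ))

section

open Module Polynomial
open scoped TensorProduct

variable {n : ℕ} {L : Submodule ℤ (Eu n)} {σ : Eu n ≃ₗ[ℝ] Eu n}

theorem natDegree_dvd_finrank_of_aeval_eq_zero {K V : Type*} [Field K] [AddCommGroup V]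
    [Module K V] {p : K[X]} (hp : Irreducible p) (f : Module.End K V)
    (hf : aeval f p = 0) : p.natDegree ∣ finrank K V := by
  have : Fact (Irreducible p) := ⟨hp⟩
  let φ : AdjoinRoot p →ₐ[K] Module.End K V :=
    Ideal.Quotient.liftₐ (Ideal.span {p}) (aeval f) (by
      intro a ha
      obtain ⟨q, rfl⟩ := Ideal.mem_span_singleton.1 ha
      rw [map_mul, hf, zero_mul])
  let _ : Module (AdjoinRoot p) V := Module.compHom V φ.toRingHom
  have : IsScalarTower K (AdjoinRoot p) V := IsScalarTower.of_algebraMap_smul fun r x => by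
    change φ (algebraMap K (AdjoinRoot p) r) x = r • x
    rw [AlgHom.commutes]
    rfl
  rw [← Module.finrank_mul_finrank K (AdjoinRoot p) V,
    (AdjoinRoot.powerBasis hp.ne_zero).finrank, AdjoinRoot.powerBasis_dim]
  exact dvd_mul_right _ _

theorem natDegree_dvd_finrank_of_aeval_eq_zero_int {M : Type*} [AddCommGroup M]
    [Module.Free ℤ M] {p : ℤ[X]} (hp : Irreducible (p.map (Int.castRingHom ℚ)))
    (f : Module.End ℤ M) (hf : aeval f p = 0) :
    p.natDegree ∣ finrank ℤ M := by
  have h := natDegree_dvd_finrank_of_aeval_eq_zero (V := ℚ ⊗[ℤ] M) hp (f.baseChange ℚ) (by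
    have := aeval_algHom_apply (Module.End.baseChangeHom ℤ ℚ M) f p
    rw [hf, map_zero] at this
    exact (aeval_map_algebraMap ℚ _ p).trans this)
  rwa [Module.finrank_baseChange,
    natDegree_map_eq_of_injective (RingHom.injective_int _)] at h

/-- A reduced even binary form of minimum at least `6` whose dual quotient is killed by `47`
is, up to sign, `[[6, 1], [1, 8]]`. -/
theorem eq_of_reduced_evenForm {a b c : ℤ} (ha : 6 ≤ 2 * a) (hab : 2 * |b| ≤ 2 * a) (hac : a ≤ c)
    (hpos : 0 < 2 * a * (2 * c) - b ^ 2)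
    (h₁ : 2 * a * (2 * c) - b ^ 2 ∣ 47 * (2 * a)) (h₂ : 2 * a * (2 * c) - b ^ 2 ∣ 47 * b)
    (h₃ : 2 * a * (2 * c) - b ^ 2 ∣ 47 * (2 * c)) :
    2 * a = 6 ∧ (b = 1 ∨ b = -1) ∧ 2 * c = 8 := by
  set D := 2 * a * (2 * c) - b ^ 2 with hD
  have hdvd : D ∣ 47 ^ 2 := by
    have h : D * D ∣ D * 47 ^ 2 := by
      have := dvd_sub (mul_dvd_mul h₁ h₃) (mul_dvd_mul h₂ h₂)
      rwa [show 47 * (2 * a) * (47 * (2 * c)) - 47 * b * (47 * b) = D * 47 ^ 2 by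
        rw [hD]; ring] at this
    exact Int.dvd_of_mul_dvd_mul_left hpos.ne' h
  have h47 : D = 47 := by
    obtain ⟨k, hk, hDk⟩ := (Nat.dvd_prime_pow (by norm_num : Nat.Prime 47)).1
      (by exact_mod_cast Int.natAbs_dvd_natAbs.2 hdvd : D.natAbs ∣ 47 ^ 2)
    have hb : b ^ 2 % 4 = 0 ∨ b ^ 2 % 4 = 1 := by
      rcases Int.even_or_odd' b with ⟨m, rfl | rfl⟩ <;> ring_nf <;> omega
    have h4 : D = 4 * (a * c) - b ^ 2 := by rw [hD]; ring
    interval_cases k <;> omega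
  have hb2 : b ^ 2 ≤ a ^ 2 := sq_le_sq' (by linarith [neg_abs_le b]) (by linarith [le_abs_self b])
  have ha' : a ≤ 3 := by nlinarith
  obtain rfl : a = 3 := by omega
  have := abs_le.1 (by linarith : |b| ≤ 3)
  obtain ⟨_, _⟩ := this
  interval_cases b <;> omega

theorem IsAutoOf.pow_mem (hσ : IsAutoOf σ L) (k : ℕ) {y : Eu n} (hy : y ∈ L) :
    (σ.toLinearMap ^ k) y ∈ L := by
  induction k with
  | zero => simpa using hy
  | succ k ih =>
    rw [pow_succ', Module.End.mul_apply]
    exact hσ.2.subset ⟨_, ih, rfl⟩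

theorem mem_fixSpace {x : Eu n} : x ∈ fixSpace σ ↔ σ x = x := by
  simp [fixSpace, sub_eq_zero]

theorem mem_latIn_fixSpace {x : Eu n} : x ∈ latIn L (fixSpace σ) ↔ x ∈ L ∧ σ x = x :=
  and_congr Iff.rfl mem_fixSpace

theorem pow_apply_of_mem_fixSpace {x : Eu n} (hx : σ x = x) (k : ℕ) :
    (σ.toLinearMap ^ k) x = x := by
  induction k with
  | zero => rfl
  | succ k ih => rw [pow_succ', Module.End.mul_apply, ih]; exact hx

theorem toLinearMap_pow_orderOf : σ.toLinearMap ^ orderOf σ = 1 := by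
  have h := congrArg LinearEquiv.automorphismGroup.toLinearMapMonoidHom (pow_orderOf_eq_one σ)
  rwa [map_pow, map_one] at h

/-- The sum of the powers of `σ` over one period. -/
def periodSum (σ : Eu n ≃ₗ[ℝ] Eu n) : Module.End ℝ (Eu n) :=
  ∑ k ∈ Finset.range (orderOf σ), σ.toLinearMap ^ k

theorem periodSum_mem_latIn (hσ : IsAutoOf σ L) {y : Eu n} (hy : y ∈ L) :
    periodSum σ y ∈ latIn L (fixSpace σ) := by
  rw [mem_latIn_fixSpace]
  refine ⟨?_, ?_⟩
  · rw [periodSum, LinearMap.sum_apply]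
    exact L.sum_mem fun k _ => hσ.pow_mem k hy
  · have h := LinearMap.congr_fun (mul_geom_sum σ.toLinearMap (orderOf σ)) y
    rw [toLinearMap_pow_orderOf] at h
    simpa [periodSum, sub_eq_zero] using h

theorem periodSum_apply_sub (x : Eu n) : periodSum σ (σ x - x) = 0 := by
  have h := LinearMap.congr_fun (geom_sum_mul σ.toLinearMap (orderOf σ)) x
  rw [toLinearMap_pow_orderOf] at h
  simpa [periodSum] using h

theorem periodSum_apply_of_fixed {x : Eu n} (hx : σ x = x) :
    periodSum σ x = (orderOf σ : ℝ) • x := by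
  simp [periodSum, LinearMap.sum_apply, pow_apply_of_mem_fixSpace hx, Nat.cast_smul_eq_nsmul]

theorem inner_periodSum_of_fixed (hσ : IsAutoOf σ L) {x : Eu n} (hx : σ x = x) (y : Eu n) :
    ⟪x, periodSum σ y⟫ = orderOf σ * ⟪x, y⟫ := by
  have h (k : ℕ) : ⟪x, (σ.toLinearMap ^ k) y⟫ = ⟪x, y⟫ := by
    induction k with
    | zero => rfl
    | succ k ih =>
      rw [pow_succ', Module.End.mul_apply, ← ih]
      conv_lhs => rw [← hx]
      exact hσ.1 _ _
  simp [periodSum, LinearMap.sum_apply, inner_sum, h]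

theorem span_latIn_fixSpace (hσ : IsAutoOf σ L) (hord : orderOf σ ≠ 0)
    (hL : Submodule.span ℝ (L : Set (Eu n)) = ⊤) :
    Submodule.span ℝ (latIn L (fixSpace σ) : Set (Eu n)) = fixSpace σ := by
  refine le_antisymm (Submodule.span_le.2 fun x hx => hx.2) fun x hx => ?_
  have h : Submodule.span ℝ (L : Set (Eu n)) ≤
      (Submodule.span ℝ (latIn L (fixSpace σ) : Set (Eu n))).comap (periodSum σ) :=
    Submodule.span_le.2 fun y hy => Submodule.subset_span (periodSum_mem_latIn hσ hy)
  have hx' := h (hL ▸ Submodule.mem_top : x ∈ _)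
  rw [Submodule.mem_comap, periodSum_apply_of_fixed (mem_fixSpace.1 hx)] at hx'
  exact (Submodule.smul_mem_iff _ (Nat.cast_ne_zero.2 hord)).1 hx'

theorem finrank_span_eq_of_discrete (N : Submodule ℤ (Eu n)) [DiscreteTopology N] :
    finrank ℝ (Submodule.span ℝ (N : Set (Eu n))) = finrank ℤ N := by
  have h := Real.finrank_eq_int_finrank_of_discrete (s := (N : Set (Eu n)))
    (by rwa [Submodule.span_eq])
  rwa [Set.finrank, Set.finrank, Submodule.span_eq] at h

theorem dvd_finrank_imSpace [DiscreteTopology L] (hσ : IsAutoOf σ L)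
    (hL : Submodule.span ℝ (L : Set (Eu n)) = ⊤) (hp : (orderOf σ).Prime) :
    orderOf σ - 1 ∣ finrank ℝ (imSpace σ) := by
  let f : Module.End ℝ (Eu n) := σ.toLinearMap
  let M : Submodule ℤ (Eu n) := L.map ((f - LinearMap.id).restrictScalars ℤ)
  have hML : M ≤ L := by
    rintro _ ⟨y, hy, rfl⟩
    exact L.sub_mem (hσ.2.subset ⟨y, hy, rfl⟩) hy
  have : DiscreteTopology M := DiscreteTopology.of_subset ‹_› hML
  have hspan : Submodule.span ℝ (M : Set (Eu n)) = imSpace σ := by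
    rw [imSpace, LinearMap.range_eq_map, ← hL, Submodule.map_span]
    rfl
  rw [← hspan, finrank_span_eq_of_discrete]
  have hfM : ∀ x ∈ M, f.restrictScalars ℤ x ∈ M := by
    rintro _ ⟨y, hy, rfl⟩
    refine ⟨f y, hσ.2.subset ⟨y, hy, rfl⟩, ?_⟩
    simp
  let g : Module.End ℤ M := (f.restrictScalars ℤ).restrict hfM
  have hg (k : ℕ) (x : M) : ((g ^ k) x : Eu n) = (f ^ k) x := by
    induction k with
    | zero => rfl
    | succ k ih =>
      rw [pow_succ', pow_succ', Module.End.mul_apply, Module.End.mul_apply, ← ih]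
      rfl
  have : Fact (orderOf σ).Prime := ⟨hp⟩
  have key := natDegree_dvd_finrank_of_aeval_eq_zero_int (p := cyclotomic (orderOf σ) ℤ)
    (by rw [map_cyclotomic]; exact cyclotomic.irreducible_rat hp.pos) g (by
      ext ⟨x, hx⟩ : 2
      obtain ⟨y, hy, rfl⟩ := id hx
      have h := periodSum_apply_sub (σ := σ) y
      rw [cyclotomic_prime, map_sum]
      simp only [map_pow, aeval_X, LinearMap.sum_apply, Submodule.coe_sum, hg]
      rw [periodSum, LinearMap.sum_apply] at h
      exact h)
  rwa [natDegree_cyclotomic, Nat.totient_prime hp] at key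

theorem discreteTopology_of_six_le_inner (L : Submodule ℤ (Eu n))
    (h : ∀ x ∈ L, x ≠ 0 → 6 ≤ ⟪x, x⟫) : DiscreteTopology L := by
  refine DiscreteTopology.of_forall_le_norm one_pos fun x hx => ?_
  have := h x x.2 (by simpa using hx)
  rw [real_inner_self_eq_norm_sq] at this
  change 1 ≤ ‖(x : Eu n)‖
  nlinarith [norm_nonneg (x : Eu n)]

theorem finrank_fixSpace {L : Submodule ℤ (Eu 48)} [DiscreteTopology L]
    {σ : Eu 48 ≃ₗ[ℝ] Eu 48} (hσ : IsAutoOf σ L)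
    (hL : Submodule.span ℝ (L : Set (Eu 48)) = ⊤) (hord : orderOf σ = 47) :
    finrank ℝ (fixSpace σ) = 2 := by
  have hd := dvd_finrank_imSpace hσ hL (by rw [hord]; norm_num)
  have hsum : finrank ℝ (imSpace σ) + finrank ℝ (fixSpace σ) = 48 := by
    exact (LinearMap.finrank_range_add_finrank_ker (σ.toLinearMap - LinearMap.id)).trans (by simp)
  have hne : finrank ℝ (imSpace σ) ≠ 0 := by
    intro h
    rw [Submodule.finrank_eq_zero, imSpace, LinearMap.range_eq_bot, sub_eq_zero] at h
    have : σ = 1 := LinearEquiv.toLinearMap_injective h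
    rw [this, orderOf_one] at hord
    omega
  rw [hord] at hd
  omega

theorem linearIndependent_pair_of_closure_eq {F : AddSubgroup (Eu n)} {b₁ b₂ : Eu n}
    (hcl : AddSubgroup.closure {b₁, b₂} = F)
    (hF : finrank ℝ (Submodule.span ℝ (F : Set (Eu n))) = 2) :
    LinearIndependent ℝ ![b₁, b₂] := by
  have hspan : Submodule.span ℝ (Set.range ![b₁, b₂]) = Submodule.span ℝ (F : Set (Eu n)) := by
    rw [Matrix.range_cons_cons_empty, ← hcl]
    refine le_antisymm (Submodule.span_mono AddSubgroup.subset_closure) (Submodule.span_le.2 ?_)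
    exact (AddSubgroup.closure_le (Submodule.span ℝ {b₁, b₂}).toAddSubgroup).2
      Submodule.subset_span
  rw [linearIndependent_iff_card_eq_finrank_span, Set.finrank, hspan, hF, Fintype.card_fin]

theorem exists_closure_pair_eq_latIn [DiscreteTopology L] (W : Submodule ℝ (Eu n))
    (hF : finrank ℝ (Submodule.span ℝ (latIn L W : Set (Eu n))) = 2) :
    ∃ b₁ b₂ : Eu n, AddSubgroup.closure {b₁, b₂} = latIn L W := by
  let F : Submodule ℤ (Eu n) := L ⊓ W.restrictScalars ℤ
  have : DiscreteTopology F := DiscreteTopology.of_subset ‹_› inf_le_left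
  have hrank : finrank ℤ F = 2 := (finrank_span_eq_of_discrete F).symm.trans hF
  let b := finBasisOfFinrankEq ℤ F hrank
  refine ⟨b 0, b 1, ?_⟩
  have h := congrArg (Submodule.map F.subtype) b.span_eq
  rw [Submodule.map_span, Submodule.map_subtype_top, ← Set.range_comp] at h
  have hr : Set.range (F.subtype ∘ b) = {(b 0 : Eu n), (b 1 : Eu n)} := by
    ext x
    simp [Fin.exists_fin_two, eq_comm]
  rw [hr] at h
  rw [← Submodule.span_int_eq_addSubgroupClosure, h]
  rfl

theorem gram_det_pos {b₁ b₂ : Eu n} (hb : LinearIndependent ℝ ![b₁, b₂]) :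
    0 < ⟪b₁, b₁⟫ * ⟪b₂, b₂⟫ - ⟪b₁, b₂⟫ ^ 2 := by
  rw [LinearIndependent.pair_iff] at hb
  have h₂ : 0 < ⟪b₂, b₂⟫ := by
    rw [real_inner_self_pos]
    rintro rfl
    exact one_ne_zero (hb 0 1 (by simp)).2
  have hv : 0 < ⟪⟪b₂, b₂⟫ • b₁ + (-⟪b₁, b₂⟫) • b₂, ⟪b₂, b₂⟫ • b₁ + (-⟪b₁, b₂⟫) • b₂⟫ := by
    rw [real_inner_self_pos]
    exact fun h => h₂.ne' (hb _ _ h).1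
  refine pos_of_mul_pos_right (a := ⟪b₂, b₂⟫) ?_ h₂.le
  refine hv.trans_eq ?_
  simp only [inner_add_left, inner_add_right, real_inner_smul_left, real_inner_smul_right,
    real_inner_comm b₁ b₂]
  ring

theorem gram_det_dvd (hσ : IsAutoOf σ L) (hord : orderOf σ ≠ 0)
    (hL : dualSet (L : Set (Eu n)) = L) {b₁ b₂ : Eu n}
    (hcl : AddSubgroup.closure {b₁, b₂} = latIn L (fixSpace σ))
    (hb : LinearIndependent ℝ ![b₁, b₂]) {a b c : ℤ}
    (ha : ⟪b₁, b₁⟫ = (a : ℝ)) (hb' : ⟪b₁, b₂⟫ = (b : ℝ)) (hc : ⟪b₂, b₂⟫ = (c : ℝ)) :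
    a * c - b ^ 2 ∣ orderOf σ * c ∧ a * c - b ^ 2 ∣ orderOf σ * b := by
  have hD := gram_det_pos hb
  rw [ha, hb', hc] at hD
  rw [LinearIndependent.pair_iff] at hb
  have h₁ : b₁ ∈ latIn L (fixSpace σ) := hcl ▸ AddSubgroup.subset_closure (by simp)
  have h₂ : b₂ ∈ latIn L (fixSpace σ) := hcl ▸ AddSubgroup.subset_closure (by simp)
  rw [mem_latIn_fixSpace] at h₁ h₂
  set D : ℝ := a * c - b ^ 2 with hDdef
  have hN : (orderOf σ : ℝ) ≠ 0 := Nat.cast_ne_zero.2 hord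
  let v : Eu n := (orderOf σ * c / D) • b₁ + (-(orderOf σ * b / D)) • b₂
  have hv : σ v = v := by simp only [v, map_add, map_smul, h₁.2, h₂.2]
  have hvL : v ∈ (L : Set (Eu n)) := by
    rw [← hL]
    intro y hy
    have hy' := periodSum_mem_latIn hσ hy
    rw [← hcl, AddSubgroup.mem_closure_pair] at hy'
    obtain ⟨p, q, hpq⟩ := hy'
    refine ⟨p, mul_left_cancel₀ hN ?_⟩
    rw [← inner_periodSum_of_fixed hσ hv, ← hpq, ← Int.cast_smul_eq_zsmul ℝ,
      ← Int.cast_smul_eq_zsmul ℝ]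
    simp only [v, inner_add_left, inner_add_right, real_inner_smul_left, real_inner_smul_right,
      real_inner_comm b₁ b₂, ha, hb', hc]
    field_simp
    rw [hDdef]
    ring
  have hvF : v ∈ latIn L (fixSpace σ) := mem_latIn_fixSpace.2 ⟨hvL, hv⟩
  rw [← hcl, AddSubgroup.mem_closure_pair] at hvF
  obtain ⟨p, q, hpq⟩ := hvF
  have hz : (p - orderOf σ * c / D) • b₁ + (q + orderOf σ * b / D) • b₂ = 0 := by
    rw [← Int.cast_smul_eq_zsmul ℝ, ← Int.cast_smul_eq_zsmul ℝ] at hpq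
    rw [← sub_eq_zero.2 hpq]
    simp only [v]
    module
  obtain ⟨hp, hq⟩ := hb _ _ hz
  have hp' : (orderOf σ * c : ℝ) = D * p := by
    field_simp at hp
    linarith
  have hq' : (orderOf σ * b : ℝ) = D * (-q) := by
    field_simp at hq
    linarith
  rw [hDdef] at hp' hq'
  exact ⟨⟨p, by exact_mod_cast hp'⟩, ⟨-q, by exact_mod_cast hq'⟩⟩

theorem closure_pair_add_zsmul {G : Type*} [AddCommGroup G] (x y : G) (k : ℤ) :
    AddSubgroup.closure {x, y + k • x} = AddSubgroup.closure {x, y} := by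
  have hx (z : G) : x ∈ AddSubgroup.closure {x, z} := AddSubgroup.subset_closure (by simp)
  have hz (z : G) : z ∈ AddSubgroup.closure {x, z} := AddSubgroup.subset_closure (by simp)
  apply le_antisymm <;> rw [AddSubgroup.closure_le, Set.insert_subset_iff, Set.singleton_subset_iff]
  · exact ⟨hx _, add_mem (hz _) (zsmul_mem (hx _) _)⟩
  · refine ⟨hx _, ?_⟩
    have := sub_mem (hz (y + k • x)) (zsmul_mem (hx (y + k • x)) k)
    rwa [add_sub_cancel_right] at this

/-- A pair of generators minimizing the sum of the norms satisfies the reduction inequality. -/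
theorem exists_reduced_pair {F : AddSubgroup (Eu n)}
    (hF : ∃ b₁ b₂ : Eu n, AddSubgroup.closure {b₁, b₂} = F)
    (heven : ∀ x ∈ F, ∃ k : ℤ, ⟪x, x⟫ = 2 * (k : ℝ)) :
    ∃ b₁ b₂ : Eu n, AddSubgroup.closure {b₁, b₂} = F ∧ ⟪b₁, b₁⟫ ≤ ⟪b₂, b₂⟫ ∧
      2 * |⟪b₁, b₂⟫| ≤ ⟪b₁, b₁⟫ := by
  have hnat : ∀ b₁ b₂ : Eu n, AddSubgroup.closure {b₁, b₂} = F →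
      ∃ m : ℕ, ⟪b₁, b₁⟫ + ⟪b₂, b₂⟫ = (m : ℝ) := by
    intro b₁ b₂ hcl
    obtain ⟨k, hk⟩ := heven b₁ (hcl ▸ AddSubgroup.subset_closure (by simp))
    obtain ⟨l, hl⟩ := heven b₂ (hcl ▸ AddSubgroup.subset_closure (by simp))
    have h : (0 : ℝ) ≤ ((2 * k + 2 * l : ℤ) : ℝ) := by
      push_cast
      rw [← hk, ← hl]
      exact add_nonneg real_inner_self_nonneg real_inner_self_nonneg
    obtain ⟨m, hm⟩ := Int.eq_ofNat_of_zero_le (Int.cast_nonneg_iff.1 h)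
    exact ⟨m, by rw [hk, hl]; exact_mod_cast hm⟩
  classical
  have hex : ∃ m : ℕ, ∃ b₁ b₂ : Eu n, AddSubgroup.closure {b₁, b₂} = F ∧
      ⟪b₁, b₁⟫ + ⟪b₂, b₂⟫ = (m : ℝ) := by
    obtain ⟨b₁, b₂, h⟩ := hF
    obtain ⟨m, hm⟩ := hnat b₁ b₂ h
    exact ⟨m, b₁, b₂, h, hm⟩
  obtain ⟨b₁, b₂, hcl, hm⟩ := Nat.find_spec hex
  have hmin : ∀ c₁ c₂ : Eu n, AddSubgroup.closure {c₁, c₂} = F →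
      ⟪b₁, b₁⟫ + ⟪b₂, b₂⟫ ≤ ⟪c₁, c₁⟫ + ⟪c₂, c₂⟫ := by
    intro c₁ c₂ hc
    obtain ⟨k, hk⟩ := hnat c₁ c₂ hc
    rw [hm, hk]
    exact_mod_cast Nat.find_min' hex ⟨c₁, c₂, hc, hk⟩
  wlog hle : ⟪b₁, b₁⟫ ≤ ⟪b₂, b₂⟫ generalizing b₁ b₂
  · rw [Set.pair_comm] at hcl
    rw [add_comm] at hm
    exact this b₂ b₁ hcl hm (fun c₁ c₂ hc => by rw [add_comm]; exact hmin c₁ c₂ hc)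
      (not_le.1 hle).le
  refine ⟨b₁, b₂, hcl, hle, ?_⟩
  have hadd := hmin b₁ (b₂ + (1 : ℤ) • b₁) ((closure_pair_add_zsmul _ _ _).trans hcl)
  have hsub := hmin b₁ (b₂ + (-1 : ℤ) • b₁) ((closure_pair_add_zsmul _ _ _).trans hcl)
  simp only [one_zsmul, neg_zsmul, inner_add_left, inner_add_right, inner_neg_left,
    inner_neg_right, real_inner_comm b₁ b₂] at hadd hsub
  have : |⟪b₁, b₂⟫| ≤ ⟪b₁, b₁⟫ / 2 := abs_le.2 ⟨by linarith, by linarith⟩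
  linarith

end

/-- If `L` is an extremal even unimodular lattice of dimension 48 and
`σ ∈ Aut(L)` has order 47, then the fixed lattice `L ∩ ker(σ-1)` is 2-dimensional
with a basis of Gram matrix `[[6,1],[1,8]]` (hence determinant 47). -/
theorem stmt5 (L : Submodule ℤ (Eu 48)) (hL : IsExtremal48 L)
    (σ : Eu 48 ≃ₗ[ℝ] Eu 48) (hσ : IsAutoOf σ L) (hord : orderOf σ = 47) :
    Module.finrank ℝ (Submodule.span ℝ ((latIn L (fixSpace σ)) : Set (Eu 48))) = 2 ∧
    ∃ b₁ b₂ : Eu 48,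
      AddSubgroup.closure {b₁, b₂} = latIn L (fixSpace σ) ∧
      ⟪b₁, b₁⟫ = (6 : ℝ) ∧ ⟪b₁, b₂⟫ = (1 : ℝ) ∧ ⟪b₂, b₂⟫ = (8 : ℝ) ∧
      ⟪b₁, b₁⟫ * ⟪b₂, b₂⟫ - ⟪b₁, b₂⟫ * ⟪b₁, b₂⟫ = (47 : ℝ) := by
  obtain ⟨hspan, heven, hdual, hmin, -⟩ := hL
  have := discreteTopology_of_six_le_inner L hmin
  have hF : Module.finrank ℝ (Submodule.span ℝ (latIn L (fixSpace σ) : Set (Eu 48))) = 2 := by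
    rw [span_latIn_fixSpace hσ (by omega) hspan, finrank_fixSpace hσ hspan hord]
  refine ⟨hF, ?_⟩
  obtain ⟨b₁, b₂, hcl, hle, hred⟩ := exists_reduced_pair
    (exists_closure_pair_eq_latIn (fixSpace σ) hF) fun x hx => heven x hx.1
  have hind := linearIndependent_pair_of_closure_eq hcl hF
  have h₁ : b₁ ∈ L := (hcl ▸ AddSubgroup.subset_closure (by simp) :
    b₁ ∈ latIn L (fixSpace σ)).1
  have h₂ : b₂ ∈ L := (hcl ▸ AddSubgroup.subset_closure (by simp) :
    b₂ ∈ latIn L (fixSpace σ)).1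
  obtain ⟨a, ha⟩ := heven b₁ h₁
  obtain ⟨c, hc⟩ := heven b₂ h₂
  obtain ⟨b, hb⟩ := hdual.superset h₁ b₂ h₂
  have h6 := hmin b₁ h₁ (hind.ne_zero 0)
  have hpos := gram_det_pos hind
  obtain ⟨hdvd_c, hdvd_b⟩ := gram_det_dvd hσ (by omega) hdual hcl hind (a := 2 * a) (c := 2 * c)
    (by push_cast; exact ha) hb (by push_cast; exact hc)
  obtain ⟨hdvd_a, -⟩ := gram_det_dvd hσ (by omega) hdual (Set.pair_comm b₁ b₂ ▸ hcl)
    (LinearIndependent.pair_symm_iff.1 hind) (a := 2 * c) (c := 2 * a)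
    (by push_cast; exact hc) ((real_inner_comm _ _).trans hb) (by push_cast; exact ha)
  rw [mul_comm (2 * c)] at hdvd_a
  rw [hord] at hdvd_a hdvd_b hdvd_c
  rw [ha] at h6
  rw [ha, hc] at hle
  rw [ha, hb] at hred
  rw [ha, hb, hc] at hpos
  obtain ⟨ha', hb', hc'⟩ := eq_of_reduced_evenForm (a := a) (b := b) (c := c)
    (by exact_mod_cast h6) (by exact_mod_cast hred)
    (by exact_mod_cast le_of_mul_le_mul_left hle two_pos)
    (by exact_mod_cast hpos) hdvd_a hdvd_b hdvd_c
  have ha₆ : ⟪b₁, b₁⟫ = (6 : ℝ) := by rw [ha]; exact_mod_cast ha'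
  have hc₈ : ⟪b₂, b₂⟫ = (8 : ℝ) := by rw [hc]; exact_mod_cast hc'
  rcases hb' with rfl | rfl
  · rw [Int.cast_one] at hb
    exact ⟨b₁, b₂, hcl, ha₆, hb, hc₈, by rw [ha₆, hb, hc₈]; norm_num⟩
  · have hb₁ : ⟪b₁, -b₂⟫ = (1 : ℝ) := by rw [inner_neg_right, hb]; norm_num
    have hc₈' : ⟪-b₂, -b₂⟫ = (8 : ℝ) := by rw [inner_neg_neg, hc₈]
    refine ⟨b₁, -b₂, ?_, ha₆, hb₁, hc₈', by rw [ha₆, hb₁, hc₈']; norm_num⟩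
    rw [← hcl, Set.insert_eq, Set.insert_eq, AddSubgroup.closure_union, AddSubgroup.closure_union,
      AddSubgroup.closure_singleton_neg]
end
end

section
/- There is no positive definite lattice of rank 8 with minimum ≥ 6 and determinant dividing 41. Consequently, an extremal even unimodular lattice of dimension 48 has no automorphism of order 41. -/
open scoped RealInnerProductSpace

noncomputable section

section Auxiliary

open MeasureTheory Module Polynomial
open scoped Matrix

theorem volume_fundamentalDomain_eq_sqrt_det_gram {ι E : Type*} [Fintype ι] [DecidableEq ι]
    [NormedAddCommGroup E] [InnerProductSpace ℝ E] [FiniteDimensional ℝ E]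
    [MeasurableSpace E] [BorelSpace E] (b : Basis ι ℝ E) :
    volume (ZSpan.fundamentalDomain b) = ENNReal.ofReal √(Matrix.gram ℝ b).det := by
  have hc : finrank ℝ E = Fintype.card ι := finrank_eq_card_basis b
  let o : OrthonormalBasis ι ℝ E :=
    (stdOrthonormalBasis ℝ E).reindex (Fintype.equivOfCardEq (by simp [hc]))
  have ho : volume (ZSpan.fundamentalDomain o.toBasis) = 1 := by
    rw [measure_congr (ZSpan.fundamentalDomain_ae_parallelepiped _ _)]
    simpa using o.volume_parallelepiped
  rw [ZSpan.measure_fundamentalDomain b volume o.toBasis, ho, mul_one,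
    Matrix.gram_eq_conjTranspose_mul o, Matrix.det_mul, Matrix.det_conjTranspose, star_trivial,
    Real.sqrt_mul_self_eq_abs]
  rfl

theorem exists_inner_self_lt_six {ι E : Type*} [Fintype ι] [DecidableEq ι]
    [NormedAddCommGroup E] [InnerProductSpace ℝ E] (b : Basis ι ℝ E)
    (hι : Fintype.card ι = 8) (hdet : (Matrix.gram ℝ b).det ≤ 41) :
    ∃ x ∈ Submodule.span ℤ (Set.range b), x ≠ 0 ∧ ⟪x, x⟫ < 6 := by
  have : FiniteDimensional ℝ E := b.finiteDimensional_of_finite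
  have hc : finrank ℝ E = 8 := (finrank_eq_card_basis b).trans hι
  have : Nontrivial E := Module.nontrivial_of_finrank_pos (R := ℝ) (by omega)
  borelize E
  have key : volume (ZSpan.fundamentalDomain b) * 2 ^ finrank ℝ E <
      volume (Metric.ball (0 : E) √6) := by
    rw [volume_fundamentalDomain_eq_sqrt_det_gram, InnerProductSpace.volume_ball, hc,
      ← ENNReal.ofReal_pow (by positivity), ← ENNReal.ofReal_mul (by positivity),
      ← ENNReal.ofReal_ofNat 2, ← ENNReal.ofReal_pow (by positivity),
      ← ENNReal.ofReal_mul (by positivity)]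
    have h6 : √6 ^ 8 = 1296 := by
      rw [show √6 ^ 8 = (√6 ^ 2) ^ 4 by ring, Real.sq_sqrt (by norm_num)]; norm_num
    have hpi : √Real.pi ^ 8 = Real.pi ^ 4 := by
      rw [show √Real.pi ^ 8 = (√Real.pi ^ 2) ^ 4 by ring, Real.sq_sqrt Real.pi_pos.le]
    have hG : Real.Gamma (((8 : ℕ) : ℝ) / 2 + 1) = 24 := by
      rw [show ((8 : ℕ) : ℝ) / 2 + 1 = ((4 : ℕ) : ℝ) + 1 by norm_num, Real.Gamma_nat_eq_factorial]
      norm_num [Nat.factorial]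
    rw [h6, hpi, hG]
    have hs : √(Matrix.gram ℝ b).det ≤ 7 := Real.sqrt_le_iff.mpr ⟨by norm_num, by linarith⟩
    have hp : (3 : ℝ) ^ 4 < Real.pi ^ 4 := by gcongr; exact Real.pi_gt_three
    apply (ENNReal.ofReal_lt_ofReal_iff (by positivity)).mpr
    linarith
  have : Countable (Submodule.span ℤ (Set.range b)).toAddSubgroup :=
    inferInstanceAs (Countable (Submodule.span ℤ (Set.range b)))
  obtain ⟨x, hx, hx'⟩ := exists_ne_zero_mem_lattice_of_measure_mul_two_pow_lt_measure
    (ZSpan.isAddFundamentalDomain' b volume) (fun x hx => by simpa using hx)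
    (convex_ball _ _) key
  refine ⟨x, x.2, by simpa using hx, ?_⟩
  rw [mem_ball_zero_iff, Real.lt_sqrt (norm_nonneg _)] at hx'
  rwa [real_inner_self_eq_norm_sq]

theorem Matrix.exists_charpoly_eq_cyclotomic_pow {κ : Type*} [Fintype κ] [DecidableEq κ]
    {n : ℕ} (hn : 0 < n) (N : Matrix κ κ ℚ) (hN : aeval N (cyclotomic n ℚ) = 0) :
    ∃ k : ℕ, N.charpoly = cyclotomic n ℚ ^ k := by
  have hirr := cyclotomic.irreducible_rat hn
  have huniq : ∀ {m : ℚ[X]}, m ∈ UniqueFactorizationMonoid.normalizedFactors N.charpoly →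
      m = cyclotomic n ℚ := by
    intro m hm
    have hmi := UniqueFactorizationMonoid.irreducible_of_normalized_factor m hm
    have hmm : m.Monic := by
      rw [← UniqueFactorizationMonoid.normalize_normalized_factor m hm]
      exact Polynomial.monic_normalize hmi.ne_zero
    obtain ⟨z, hz⟩ := IsAlgClosed.exists_aeval_eq_zero ℂ m hmi.degree_pos.ne'
    have hz' : aeval z N.charpoly = 0 :=
      aeval_eq_zero_of_dvd_aeval_eq_zero
        (UniqueFactorizationMonoid.dvd_of_mem_normalizedFactors hm) hz
    have hspec : z ∈ spectrum ℂ (N.map (algebraMap ℚ ℂ)) := by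
      rw [Matrix.mem_spectrum_iff_isRoot_charpoly, Matrix.charpoly_map, IsRoot.def,
        eval_map_algebraMap, hz']
    have hΦ : aeval (N.map (algebraMap ℚ ℂ)) (cyclotomic n ℂ) = 0 := by
      rw [← map_cyclotomic n (algebraMap ℚ ℂ), aeval_map_algebraMap]
      have := congrArg ((Algebra.ofId ℚ ℂ).mapMatrix) hN
      rw [map_zero, ← aeval_algHom_apply] at this
      exact this
    have hzΦ : aeval z (cyclotomic n ℚ) = 0 := by
      have h0 := spectrum.subset_polynomial_aeval (N.map (algebraMap ℚ ℂ)) (cyclotomic n ℂ)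
        ⟨z, hspec, rfl⟩
      have : Nontrivial (Matrix κ κ ℂ) := by
        by_contra h
        rw [not_nontrivial_iff_subsingleton] at h
        simp [spectrum.of_subsingleton] at hspec
      rw [hΦ, spectrum.zero_eq, Set.mem_singleton_iff] at h0
      rwa [← eval_map_algebraMap, map_cyclotomic]
    rw [minpoly.eq_of_irreducible_of_monic hmi hz hmm,
      minpoly.eq_of_irreducible_of_monic hirr hzΦ (cyclotomic.monic n ℚ)]
  obtain ⟨k, hk⟩ := UniqueFactorizationMonoid.exists_associated_prime_pow_of_unique_normalized_factor
    huniq N.charpoly_monic.ne_zero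
  exact ⟨k, (eq_of_monic_of_associated ((cyclotomic.monic n ℚ).pow k) N.charpoly_monic hk).symm⟩

theorem Matrix.exists_det_one_sub_eq_prime_pow {κ : Type*} [Fintype κ] [DecidableEq κ]
    {p : ℕ} [Fact p.Prime] (N : Matrix κ κ ℤ) (hN : N ^ p = 1) (hdet : (1 - N).det ≠ 0) :
    ∃ k : ℕ, Fintype.card κ = k * (p - 1) ∧ (1 - N).det = (p : ℤ) ^ k := by
  have hcast : (1 - N).map (Int.castRingHom ℚ) = 1 - N.map (Int.castRingHom ℚ) := by
    simpa using map_sub (Int.castRingHom ℚ).mapMatrix 1 N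
  have hN' : N.map (Int.castRingHom ℚ) ^ p = 1 := by
    have := congrArg (Int.castRingHom ℚ).mapMatrix hN
    rwa [map_pow, map_one] at this
  have hdet' : (1 - N.map (Int.castRingHom ℚ)).det = (1 - N).det := by
    rw [← hcast]
    exact ((Int.castRingHom ℚ).map_det _).symm
  generalize N.map (Int.castRingHom ℚ) = M at hN' hdet'
  have hΦ : aeval M (cyclotomic p ℚ) = 0 := by
    have h := congrArg (aeval M) (cyclotomic_prime_mul_X_sub_one ℚ p)
    simp only [map_mul, map_sub, map_pow, aeval_X, map_one, hN', sub_self] at h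
    have hu : IsUnit (M - 1) := by
      rw [← IsUnit.neg_iff, neg_sub, Matrix.isUnit_iff_isUnit_det, hdet']
      simpa using hdet
    exact hu.mul_left_eq_zero.mp h
  obtain ⟨k, hk⟩ := M.exists_charpoly_eq_cyclotomic_pow (Fact.out (p := p.Prime)).pos hΦ
  refine ⟨k, ?_, ?_⟩
  · have := congrArg natDegree hk
    rwa [M.charpoly_natDegree_eq_dim, natDegree_pow, natDegree_cyclotomic,
      Nat.totient_prime Fact.out] at this
  · have := congrArg (eval 1) hk
    rw [Matrix.eval_charpoly, eval_pow, eval_one_cyclotomic_prime, map_one, hdet'] at this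
    exact_mod_cast this

theorem Matrix.fromBlocks_one_zero_pow {ι κ R : Type*} [Fintype ι] [DecidableEq ι] [Fintype κ]
    [DecidableEq κ] [CommRing R] (U : Matrix ι κ R) (N : Matrix κ κ R) (n : ℕ) :
    ∃ V : Matrix ι κ R, fromBlocks (1 : Matrix ι ι R) U 0 N ^ n =
      fromBlocks (1 : Matrix ι ι R) V 0 (N ^ n) := by
  induction n with
  | zero => exact ⟨0, by simp [fromBlocks_one]⟩
  | succ n ih =>
    obtain ⟨V, hV⟩ := ih
    exact ⟨U + V * N, by rw [pow_succ, hV, fromBlocks_multiply]; simp [pow_succ]⟩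

theorem Matrix.fromBlocks_one_zero_pow_mulVec {ι κ R : Type*} [Fintype ι] [DecidableEq ι]
    [Fintype κ] [DecidableEq κ] [CommRing R] {U : Matrix ι κ R} {N : Matrix κ κ R} {v : κ → R}
    (hv : N *ᵥ v = v) (n : ℕ) :
    fromBlocks (1 : Matrix ι ι R) U 0 N ^ n *ᵥ Sum.elim 0 v = Sum.elim (n • (U *ᵥ v)) v := by
  induction n with
  | zero => simp
  | succ n ih =>
    rw [pow_succ', ← mulVec_mulVec, ih, fromBlocks_mulVec]
    simp [hv, add_smul]

/-- If an isometry of a form with matrix `A` fixes the first block of basis vectors and acts as `N`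
on the quotient, the Gram determinant of that block divides `A.det * (1 - N).det`. -/
theorem Matrix.det_dvd_det_mul_det_one_sub {ι κ R : Type*} [Fintype ι] [DecidableEq ι]
    [Fintype κ] [DecidableEq κ] [CommRing R] (A : Matrix (ι ⊕ κ) (ι ⊕ κ) R) (U : Matrix ι κ R)
    (N : Matrix κ κ R) (h : (fromBlocks 1 U 0 N)ᵀ * A * fromBlocks 1 U 0 N = A) :
    A.toBlocks₁₁.det ∣ A.det * (1 - N).det := by
  obtain ⟨P, Q, Q', S, rfl⟩ : ∃ P Q Q' S, A = fromBlocks P Q Q' S :=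
    ⟨_, _, _, _, (fromBlocks_toBlocks A).symm⟩
  have h12 : P * U + Q * N = Q := by
    rw [fromBlocks_transpose, fromBlocks_multiply, fromBlocks_multiply] at h
    simpa using congrArg toBlocks₁₂ h
  have key : fromBlocks P Q Q' S * fromBlocks 1 (-U) 0 (1 - N) =
      fromBlocks P 0 Q' (S * (1 - N) - Q' * U) := by
    rw [fromBlocks_multiply]
    congr 1
    · simp
    · rw [Matrix.mul_sub, Matrix.mul_one, Matrix.mul_neg, neg_add_eq_zero, eq_sub_iff_add_eq, h12]
    · simp
    · simp [sub_eq_add_neg, add_comm]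
  have := congrArg det key
  rw [det_mul, det_fromBlocks_zero₂₁, det_fromBlocks_zero₁₂, det_one, one_mul] at this
  rw [toBlocks_fromBlocks₁₁, this]
  exact dvd_mul_right _ _

theorem LinearMap.exists_basis_fixed {M : Type*} [AddCommGroup M] [Module.Free ℤ M]
    [Module.Finite ℤ M] (τ : M →ₗ[ℤ] M) :
    ∃ (m n : ℕ) (b : Module.Basis (Fin m ⊕ Fin n) ℤ M),
      ∀ x, τ x = x ↔ ∀ j, b.repr x (Sum.inr j) = 0 := by
  let F := LinearMap.ker (τ - 1)
  have : Module.IsTorsionFree ℤ (M ⧸ F) :=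
    (τ - 1).quotKerEquivRange.injective.moduleIsTorsionFree _ (map_smul _)
  let c := Module.finBasis ℤ (M ⧸ F)
  refine ⟨_, _, (Module.finBasis ℤ F).sumQuot c, fun x => ?_⟩
  have h : τ x = x ↔ F.mkQ x = 0 := by
    simp [F, Submodule.mkQ_apply, Submodule.Quotient.mk_eq_zero, sub_eq_zero]
  simp only [Module.Basis.sumQuot_repr_inr, h]
  exact c.ext_elem_iff.trans (by simp)

theorem Matrix.card_eq_and_det_one_sub_of_pow_eq_one {ι κ : Type*} [Fintype ι] [DecidableEq ι]
    [Fintype κ] [DecidableEq κ] {p : ℕ} [Fact p.Prime] (U : Matrix ι κ ℤ) (N : Matrix κ κ ℤ)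
    (hpow : fromBlocks (1 : Matrix ι ι ℤ) U 0 N ^ p = 1)
    (hfix : ∀ w, fromBlocks (1 : Matrix ι ι ℤ) U 0 N *ᵥ w = w → ∀ j, w (Sum.inr j) = 0) :
    ∃ k : ℕ, Fintype.card κ = k * (p - 1) ∧ (1 - N).det = (p : ℤ) ^ k := by
  have hN : N ^ p = 1 := by
    obtain ⟨V, hV⟩ := fromBlocks_one_zero_pow U N p
    simpa [← fromBlocks_one, hpow] using congrArg toBlocks₂₂ hV.symm
  refine exists_det_one_sub_eq_prime_pow N hN fun h0 => ?_
  obtain ⟨v, hv0, hv⟩ := exists_mulVec_eq_zero_iff.mpr h0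
  have hv' : N *ᵥ v = v := by
    rw [sub_mulVec, one_mulVec, sub_eq_zero] at hv
    exact hv.symm
  have hU : U *ᵥ v = 0 := by
    have h := fromBlocks_one_zero_pow_mulVec (U := U) hv' p
    rw [hpow, one_mulVec] at h
    have h := congrArg (· ∘ Sum.inl) h
    simp only [Sum.elim_comp_inl] at h
    exact (smul_eq_zero.mp h.symm).resolve_left (Fact.out (p := p.Prime)).ne_zero
  apply hv0
  funext j
  simpa using hfix (Sum.elim 0 v) (by simp [fromBlocks_mulVec, hv', hU]) j

/-- A rank-8 lattice of determinant at most 41 has a nonzero vector of norm less than 6. -/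
theorem exists_mem_span_inner_self_lt_six {ι E : Type*} [Fintype ι] [DecidableEq ι]
    [NormedAddCommGroup E] [InnerProductSpace ℝ E] {v : ι → E} (hv : LinearIndependent ℝ v)
    (hι : Fintype.card ι = 8) (hdet : (Matrix.gram ℝ v).det ≤ 41) :
    ∃ x ∈ Submodule.span ℤ (Set.range v), x ≠ 0 ∧ ⟪x, x⟫ < 6 := by
  let b := Basis.span hv
  have hb : ∀ i, (b i : E) = v i := fun i => congrArg Subtype.val (Basis.span_apply hv i)
  have hgram : Matrix.gram ℝ b = Matrix.gram ℝ v := by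
    ext i j
    simp [Matrix.gram_apply, ← hb]
  obtain ⟨x, hx, hx0, hx6⟩ := exists_inner_self_lt_six b hι (hgram ▸ hdet)
  refine ⟨x, ?_, by simpa using hx0, by simpa using hx6⟩
  have := Submodule.mem_map_of_mem (f := (Submodule.span ℝ (Set.range v)).subtype.restrictScalars ℤ)
    hx
  rwa [Submodule.map_span, ← Set.range_comp,
    show (Submodule.span ℝ (Set.range v)).subtype.restrictScalars ℤ ∘ b = v from funext hb] at this

theorem Matrix.gram_sum_smul {ι E : Type*} [Fintype ι] [NormedAddCommGroup E]
    [InnerProductSpace ℝ E] (v : ι → E) (M : Matrix ι ι ℝ) :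
    gram ℝ (fun j => ∑ k, M k j • v k) = Mᵀ * gram ℝ v * M := by
  ext i j
  simp only [gram_apply, mul_apply, transpose_apply, inner_sum, sum_inner, inner_smul_left,
    inner_smul_right, Finset.mul_sum, Finset.sum_mul, conj_trivial]
  refine Finset.sum_congr rfl fun k _ => Finset.sum_congr rfl fun l _ => ?_
  ring

section UnimodularLattice

variable {n : ℕ} {L : Submodule ℤ (Eu n)}

theorem discreteTopology_of_le_inner_self {r : ℝ} (hr : 0 < r)
    (hL : ∀ x ∈ L, x ≠ 0 → r ≤ ⟪x, x⟫) : DiscreteTopology L := by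
  refine DiscreteTopology.of_forall_le_dist (Real.sqrt_pos.mpr hr) fun x y hxy => ?_
  change √r ≤ dist x y
  rw [Subtype.dist_eq, dist_eq_norm]
  refine Real.sqrt_le_iff.mpr ⟨norm_nonneg _, ?_⟩
  rw [← real_inner_self_eq_norm_sq]
  exact hL _ (L.sub_mem x.2 y.2) (sub_ne_zero.mpr (Subtype.coe_injective.ne hxy))

theorem coe_eq_sum_repr_smul {ι : Type*} [Fintype ι] (b : Basis ι ℤ L) (x : L) :
    (x : Eu n) = ∑ k, (b.repr x k : ℝ) • (b k : Eu n) := by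
  have h := congrArg L.subtype (b.sum_repr x)
  rw [map_sum] at h
  simp only [map_smul, Submodule.subtype_apply] at h
  simp only [Int.cast_smul_eq_zsmul, h]

theorem isUnit_det_of_dualSet_eq {ι : Type*} [Fintype ι] [DecidableEq ι] [DiscreteTopology L]
    [IsZLattice ℝ L] (hdual : dualSet (L : Set (Eu n)) = L) (b : Basis ι ℤ L)
    {A : Matrix ι ι ℤ} (hA : ∀ i j, (A i j : ℝ) = ⟪(b i : Eu n), (b j : Eu n)⟫) :
    IsUnit A.det := by
  let b' := b.ofZLatticeBasis ℝ L
  let d : ι → Eu n := fun i =>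
    (InnerProductSpace.toDual ℝ (Eu n)).symm (LinearMap.toContinuousLinearMap (b'.coord i))
  have hd : ∀ i (y : L), ⟪d i, (y : Eu n)⟫ = (b.repr y i : ℝ) := fun i y => by
    simp only [d, InnerProductSpace.toDual_symm_apply]
    exact b.ofZLatticeBasis_repr_apply ℝ L y i
  have hdL : ∀ i, d i ∈ L := fun i => by
    rw [← SetLike.mem_coe, ← hdual]
    exact fun y hy => ⟨_, hd i ⟨y, hy⟩⟩
  let C : Matrix ι ι ℤ := .of fun i k => b.repr ⟨d i, hdL i⟩ k
  have hC : ∀ i, d i = ∑ k, (C i k : ℝ) • (b k : Eu n) := fun i =>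
    coe_eq_sum_repr_smul b ⟨d i, hdL i⟩
  refine Matrix.isUnit_det_of_left_inverse (B := C) ?_
  ext i j
  have h : ((C * A) i j : ℝ) = ⟪d i, (b j : Eu n)⟫ := by
    rw [hC i, sum_inner, Matrix.mul_apply]
    push_cast
    exact Finset.sum_congr rfl fun k _ => by rw [hA, real_inner_smul_left]
  rw [hd] at h
  rw [Int.cast_injective h]
  simp [Matrix.one_apply, Finsupp.single_apply, eq_comm]

theorem transpose_toMatrix_mul_gram_mul {ι : Type*} [Fintype ι] [DecidableEq ι] (b : Basis ι ℤ L)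
    {A : Matrix ι ι ℤ} (hA : ∀ i j, (A i j : ℝ) = ⟪(b i : Eu n), (b j : Eu n)⟫)
    {τ : L →ₗ[ℤ] L} (hτ : ∀ x y, ⟪(τ x : Eu n), (τ y : Eu n)⟫ = ⟪(x : Eu n), (y : Eu n)⟫) :
    (LinearMap.toMatrix b b τ)ᵀ * A * LinearMap.toMatrix b b τ = A := by
  set B := LinearMap.toMatrix b b τ with hB
  have hA' : A.map (Int.castRingHom ℝ) = Matrix.gram ℝ (fun i => (b i : Eu n)) := Matrix.ext hA
  have hτb : ∀ j, (τ (b j) : Eu n) = ∑ k, B.map (Int.castRingHom ℝ) k j • (b k : Eu n) := by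
    intro j
    simpa [hB, LinearMap.toMatrix_apply] using coe_eq_sum_repr_smul b (τ (b j))
  refine Matrix.map_injective (f := Int.castRingHom ℝ) Int.cast_injective ?_
  beta_reduce
  rw [Matrix.map_mul, Matrix.map_mul, Matrix.transpose_map, hA', ← Matrix.gram_sum_smul]
  ext i j
  simp only [← hτb, Matrix.gram_apply, hτ]

end UnimodularLattice

/-- A unimodular lattice of rank 48 with an isometry of order 41 has a short vector, found in the
fixed lattice, which has rank 8 and determinant dividing 41. -/
theorem exists_mem_inner_self_lt_six_of_pow_eq_one {L : Submodule ℤ (Eu 48)} [DiscreteTopology L]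
    [IsZLattice ℝ L] (hdual : dualSet (L : Set (Eu 48)) = L) {τ : L →ₗ[ℤ] L}
    (hτ : ∀ x y, ⟪(τ x : Eu 48), (τ y : Eu 48)⟫ = ⟪(x : Eu 48), (y : Eu 48)⟫)
    (hpow : τ ^ 41 = 1) (hne : τ ≠ 1) :
    ∃ x ∈ L, x ≠ 0 ∧ ⟪x, x⟫ < 6 := by
  have : Module.Finite ℤ L := ZLattice.module_finite ℝ L
  have : Module.Free ℤ L := ZLattice.module_free ℝ L
  obtain ⟨r, s, b, hb⟩ := LinearMap.exists_basis_fixed τ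
  have hrs : r + s = 48 := by
    have h := finrank_eq_card_basis b
    rw [ZLattice.rank ℝ L, finrank_euclideanSpace_fin] at h
    simpa using h.symm
  have hint : ∀ i j, ∃ k : ℤ, (k : ℝ) = ⟪(b i : Eu 48), (b j : Eu 48)⟫ := fun i j => by
    have h : (b i : Eu 48) ∈ dualSet (L : Set (Eu 48)) := by
      rw [hdual]
      exact (b i).2
    obtain ⟨k, hk⟩ := h (b j) (b j).2
    exact ⟨k, hk.symm⟩
  choose A hA using hint
  have hunit : IsUnit (Matrix.det (.of A)) := isUnit_det_of_dualSet_eq hdual b hA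
  have hinv := transpose_toMatrix_mul_gram_mul b (A := .of A) hA hτ
  have hBpow : LinearMap.toMatrix b b τ ^ 41 = 1 := by
    rw [LinearMap.toMatrix_pow, hpow, LinearMap.toMatrix_one]
  have hBfix : ∀ w, LinearMap.toMatrix b b τ *ᵥ w = w → ∀ j, w (Sum.inr j) = 0 := by
    intro w hw j
    have h : τ (b.equivFun.symm w) = b.equivFun.symm w := by
      apply b.equivFun.injective
      have h := LinearMap.toMatrix_mulVec_repr b b τ (b.equivFun.symm w)
      rw [← b.equivFun_apply, ← b.equivFun_apply, LinearEquiv.apply_symm_apply, hw] at h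
      rw [← h, LinearEquiv.apply_symm_apply]
    have hj := (hb _).mp h j
    rwa [← b.equivFun_apply, LinearEquiv.apply_symm_apply] at hj
  have hinl : ∀ i, τ (b (Sum.inl i)) = b (Sum.inl i) := fun i => (hb _).mpr (by simp)
  have hB : LinearMap.toMatrix b b τ =
      Matrix.fromBlocks 1 (LinearMap.toMatrix b b τ).toBlocks₁₂ 0
        (LinearMap.toMatrix b b τ).toBlocks₂₂ := by
    conv_lhs => rw [← Matrix.fromBlocks_toBlocks (LinearMap.toMatrix b b τ)]
    congr 1
    · ext i j
      simp [Matrix.toBlocks₁₁, LinearMap.toMatrix_apply, hinl, Matrix.one_apply,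
        Finsupp.single_apply, eq_comm]
    · ext i j
      simp [Matrix.toBlocks₂₁, LinearMap.toMatrix_apply, hinl]
  generalize (LinearMap.toMatrix b b τ).toBlocks₁₂ = U at hB
  generalize (LinearMap.toMatrix b b τ).toBlocks₂₂ = N at hB
  rw [hB] at hinv hBpow hBfix
  have : Fact (Nat.Prime 41) := ⟨by norm_num⟩
  obtain ⟨k, hk, hdet⟩ := Matrix.card_eq_and_det_one_sub_of_pow_eq_one U N hBpow hBfix
  rw [Fintype.card_fin] at hk
  have hs : s ≠ 0 := by
    rintro rfl
    exact hne (LinearMap.ext fun x => (hb x).mpr fun j => j.elim0)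
  obtain ⟨rfl, rfl⟩ : k = 1 ∧ r = 8 := by omega
  have hdvd : (Matrix.of A).toBlocks₁₁.det ∣ 41 := by
    have h := Matrix.det_dvd_det_mul_det_one_sub (.of A) U N hinv
    rwa [hdet, hunit.dvd_mul_left, pow_one] at h
  have hli : LinearIndependent ℝ (fun i : Fin 8 => (b (Sum.inl i) : Eu 48)) := by
    have h := (b.ofZLatticeBasis ℝ L).linearIndependent.comp Sum.inl Sum.inl_injective
    simpa [Function.comp_def] using h
  obtain ⟨x, hx, hx0, hx6⟩ := exists_mem_span_inner_self_lt_six hli (by simp) (by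
    have h : Matrix.gram ℝ (fun i : Fin 8 => (b (Sum.inl i) : Eu 48)) =
        (Matrix.of A).toBlocks₁₁.map (Int.castRingHom ℝ) := by
      ext i j
      exact (hA _ _).symm
    rw [h, ← RingHom.mapMatrix_apply, ← RingHom.map_det, eq_intCast]
    exact_mod_cast Int.le_of_dvd (by norm_num) hdvd)
  refine ⟨x, ?_, hx0, hx6⟩
  exact Submodule.span_le.mpr (by rintro _ ⟨i, rfl⟩; exact (b _).2) hx

end Auxiliary

/-- STATEMENT: There is no positive definite lattice of rank 8 with minimum ≥ 6
and determinant dividing 41; consequently an extremal even unimodular lattice of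
dimension 48 has no automorphism of order 41. -/
theorem stmt7 :
    (¬ ∃ b : Fin 8 → Eu 8, LinearIndependent ℝ b ∧
      (∃ G : Matrix (Fin 8) (Fin 8) ℤ,
        (∀ i j, (G i j : ℝ) = ⟪b i, b j⟫) ∧  G.det ∣ 41) ∧
      (∀ x ∈ Submodule.span ℤ (Set.range b), x ≠ 0 → 6 ≤ ⟪x, x⟫)) ∧
    (∀ L : Submodule ℤ (Eu 48), IsExtremal48 L →
      ∀ σ : Eu 48 ≃ₗ[ℝ] Eu 48, IsAutoOf σ L → orderOf σ ≠ 41) := by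
  refine ⟨?_, fun L ⟨hspan, _, hdual, hmin, _⟩ σ ⟨hσ, hσL⟩ hord => ?_⟩
  · rintro ⟨b, hb, ⟨G, hG, hdet⟩, hmin⟩
    have hgram : Matrix.gram ℝ b = G.map (Int.castRingHom ℝ) :=
      Matrix.ext fun i j => (hG i j).symm
    obtain ⟨x, hx, hx0, hx6⟩ := exists_mem_span_inner_self_lt_six hb (by simp) (by
      rw [hgram, ← RingHom.mapMatrix_apply, ← RingHom.map_det, eq_intCast]
      exact_mod_cast Int.le_of_dvd (by norm_num) hdet)
    exact (hmin x hx hx0).not_gt hx6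
  · have : DiscreteTopology L := discreteTopology_of_le_inner_self (by norm_num) hmin
    have : IsZLattice ℝ L := ⟨hspan⟩
    have hmem : ∀ x ∈ L, (σ.toLinearMap.restrictScalars ℤ) x ∈ L := fun x hx => by
      rw [← SetLike.mem_coe, ← hσL]
      exact Set.mem_image_of_mem σ hx
    let τ : L →ₗ[ℤ] L := (σ.toLinearMap.restrictScalars ℤ).restrict hmem
    have hτ : ∀ k (x : L), ((τ ^ k) x : Eu 48) = (σ ^ k) x := by
      intro k
      induction k with
      | zero => simp
      | succ k ih =>
        intro x
        rw [pow_succ, pow_succ, Module.End.mul_apply, ih]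
        rfl
    obtain ⟨x, hx, hx0, hx6⟩ := exists_mem_inner_self_lt_six_of_pow_eq_one hdual (τ := τ)
      (fun x y => hσ x y)
      (LinearMap.ext fun x => Subtype.ext (by
        rw [hτ, ← hord, pow_orderOf_eq_one]
        rfl))
      (fun h => by
        have h1 : σ = 1 := by
          refine LinearEquiv.toLinearMap_injective (LinearMap.ext_on hspan fun x hx => ?_)
          exact congrArg Subtype.val (LinearMap.congr_fun h ⟨x, hx⟩)
        simp [h1] at hord)
    exact (hmin x hx hx0).not_gt hx6
end
end

section
/- There is no positive definite lattice of rank 12 with minimum ≥ 6 and determinant dividing 37, since 6/37^{1/12} exceeds the upper bound 2.6494 on the Hermite constant γ_12 ≤ 2.5218 (Cohn–Elkies). Consequently an extremal even unimodular 48-dimensional lattice has no automorphism of order 37. -/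
open scoped RealInnerProductSpace

noncomputable section

open Module Polynomial MeasureTheory

theorem exists_short_lattice_vector {b : Fin 12 → Eu 12} (hb : LinearIndependent ℝ b)
    {G : Matrix (Fin 12) (Fin 12) ℤ} (hG : ∀ i j, (G i j : ℝ) = ⟪b i, b j⟫) (hdet : G.det ≤ 37) :
    ∃ x ∈ Submodule.span ℤ (Set.range b), x ≠ 0 ∧ ⟪x, x⟫ < 6 := by
  let B : Basis (Fin 12) ℝ (Eu 12) := basisOfLinearIndependentOfCardEqFinrank hb (by simp)
  have hB : ⇑B = b := coe_basisOfLinearIndependentOfCardEqFinrank hb _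
  let o := EuclideanSpace.basisFun (Fin 12) ℝ
  have hgram : (o.toBasis.toMatrix b).transpose * o.toBasis.toMatrix b
      = G.map (Int.cast : ℤ → ℝ) := by
    ext i j
    simp [Matrix.mul_apply, Basis.toMatrix_apply, hG, o, PiLp.inner_apply, mul_comm]
  have hsq : (o.toBasis.det b) ^ 2 = (G.det : ℝ) := by
    have h := congrArg Matrix.det hgram
    rw [Matrix.det_mul, Matrix.det_transpose] at h
    rw [Basis.det_apply, sq, h]
    exact ((Int.castRingHom ℝ).map_det G).symm
  have hle : |o.toBasis.det b| ≤ 7 := by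
    apply abs_le_of_sq_le_sq _ (by norm_num)
    rw [hsq]
    have : (G.det : ℝ) ≤ 37 := by exact_mod_cast hdet
    linarith
  have hvol : volume (ZSpan.fundamentalDomain B) ≤ ENNReal.ofReal 7 := by
    rw [ZSpan.measure_fundamentalDomain B volume o.toBasis, hB,
      measure_congr (ZSpan.fundamentalDomain_ae_parallelepiped o.toBasis volume),
      OrthonormalBasis.coe_toBasis, OrthonormalBasis.volume_parallelepiped, mul_one]
    exact ENNReal.ofReal_le_ofReal hle
  have hball : volume (ZSpan.fundamentalDomain B) * 2 ^ finrank ℝ (Eu 12)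
      < volume (Metric.ball (0 : Eu 12) √6) := by
    rw [InnerProductSpace.volume_ball_of_dim_even (k := 6) (by simp)]
    refine (mul_le_mul_left hvol _).trans_lt ?_
    rw [finrank_euclideanSpace_fin, ← ENNReal.ofReal_pow (by positivity),
      ← ENNReal.ofReal_mul (by positivity),
      show (2 : ENNReal) ^ 12 = ENNReal.ofReal (2 ^ 12) by
        rw [ENNReal.ofReal_pow (by norm_num)]; norm_num,
      ← ENNReal.ofReal_mul (by positivity)]
    rw [ENNReal.ofReal_lt_ofReal_iff (by positivity)]
    have h6 : √6 ^ 12 = 6 ^ 6 := by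
      rw [show 12 = 2 * 6 from rfl, pow_mul, Real.sq_sqrt (by norm_num)]
    have hpi : (3 : ℝ) ^ 6 ≤ Real.pi ^ 6 :=
      pow_le_pow_left₀ (by norm_num) Real.pi_gt_three.le 6
    rw [h6, show Nat.factorial 6 = 720 from rfl]
    norm_num at hpi ⊢
    linarith
  have : Countable (Submodule.span ℤ (Set.range B)).toAddSubgroup :=
    inferInstanceAs (Countable (Submodule.span ℤ (Set.range B)))
  obtain ⟨x, hx0, hx⟩ := exists_ne_zero_mem_lattice_of_measure_mul_two_pow_lt_measure
    (ZSpan.isAddFundamentalDomain' B volume) (fun x hx => by simpa using hx)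
    (convex_ball (0 : Eu 12) √6) hball
  refine ⟨x, by simpa [hB] using x.2, by simpa using hx0, ?_⟩
  rw [real_inner_self_eq_norm_sq]
  rw [mem_ball_zero_iff] at hx
  calc ‖(x : Eu 12)‖ ^ 2 < √6 ^ 2 := pow_lt_pow_left₀ hx (norm_nonneg _) two_ne_zero
    _ = 6 := Real.sq_sqrt (by norm_num)

theorem natDegree_dvd_finrank_of_aeval_eq_zero_s8 {k V : Type*} [Field k] [AddCommGroup V]
    [Module k V] {P : k[X]} (hP : Irreducible P) (g : End k V)
    (hg : aeval g P = 0) : P.natDegree ∣ finrank k V := by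
  have := Fact.mk hP
  let ρ : AdjoinRoot P →ₐ[k] End k V := Ideal.Quotient.liftₐ _ (aeval g) (by
    intro a ha
    obtain ⟨c, rfl⟩ := Ideal.mem_span_singleton'.1 ha
    rw [map_mul, hg, mul_zero])
  let : Module (AdjoinRoot P) V := Module.compHom V ρ.toRingHom
  have : IsScalarTower k (AdjoinRoot P) V := ⟨fun a b v => by
    change ρ (a • b) v = a • ρ b v
    rw [map_smul, LinearMap.smul_apply]⟩
  have h := Module.finrank_mul_finrank k (AdjoinRoot P) V
  rw [(AdjoinRoot.powerBasis hP.ne_zero).finrank, AdjoinRoot.powerBasis_dim] at h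
  exact ⟨_, h.symm⟩

theorem charpoly_eq_of_aeval_eq_zero {k V : Type*} [Field k] [AddCommGroup V]
    [Module k V] [FiniteDimensional k V] {P : k[X]} (hP : Irreducible P) (hm : P.Monic)
    (g : End k V) (hg : aeval g P = 0) (hd : finrank k V = P.natDegree) :
    g.charpoly = P := by
  have : Nontrivial V := by
    apply Module.nontrivial_of_finrank_pos (R := k)
    rw [hd]
    exact hP.natDegree_pos
  have h1 : P = minpoly k g := minpoly.eq_of_irreducible_of_monic hP hg hm
  refine (eq_of_monic_of_dvd_of_natDegree_le hm g.charpoly_monic ?_ ?_)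
  · rw [h1]
    exact LinearMap.minpoly_dvd_charpoly g
  · rw [LinearMap.charpoly_natDegree, hd]

theorem finrank_and_det_of_aeval_cyclotomic {p : ℕ} [hp : Fact p.Prime] {M : Type*}
    [AddCommGroup M] [Module.Free ℤ M] [Module.Finite ℤ M] (f : End ℤ M)
    (hf : aeval f (cyclotomic p ℤ) = 0) (h0 : 0 < finrank ℤ M)
    (h2 : finrank ℤ M < 2 * (p - 1)) :
    finrank ℤ M = p - 1 ∧ LinearMap.det (1 - f) = (p : ℤ) := by
  let g : End ℚ (TensorProduct ℤ ℚ M) := f.baseChange ℚ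
  have hirr : Irreducible (cyclotomic p ℚ) := cyclotomic.irreducible_rat hp.out.pos
  have hdeg : (cyclotomic p ℚ).natDegree = p - 1 := by
    rw [natDegree_cyclotomic, Nat.totient_prime hp.out]
  have hg : aeval g (cyclotomic p ℚ) = 0 := by
    rw [← map_cyclotomic_int, ← algebraMap_int_eq, aeval_map_algebraMap]
    have h := aeval_algHom_apply (Module.End.baseChangeHom ℤ ℚ M) f (cyclotomic p ℤ)
    rw [hf, map_zero] at h
    exact h
  have hfr : finrank ℚ (TensorProduct ℤ ℚ M) = finrank ℤ M := finrank_baseChange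
  have hdvd := natDegree_dvd_finrank_of_aeval_eq_zero_s8 hirr g hg
  rw [hdeg, hfr] at hdvd
  have hrank : finrank ℤ M = p - 1 := by
    obtain ⟨c, hc⟩ := hdvd
    have : c < 2 := by
      by_contra! h
      nlinarith
    interval_cases c <;> omega
  refine ⟨hrank, ?_⟩
  have hch := charpoly_eq_of_aeval_eq_zero hirr (cyclotomic.monic p ℚ) g hg
    (by rw [hfr, hrank, hdeg])
  rw [LinearMap.charpoly_baseChange, ← map_cyclotomic_int] at hch
  have hch' : f.charpoly = cyclotomic p ℤ := map_injective _ Int.cast_injective hch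
  have h1 := LinearMap.eval_charpoly f 1
  rw [hch', eval_one_cyclotomic_prime, map_one] at h1
  exact h1.symm

theorem index_range_eq_natAbs_det {M : Type*} [AddCommGroup M] [Module.Free ℤ M]
    [Module.Finite ℤ M] (f : End ℤ M) (hf : Function.Injective f) :
    f.range.toAddSubgroup.index = (LinearMap.det f).natAbs :=
  (Submodule.natAbs_det_equiv f.range (LinearEquiv.ofInjective f hf)).symm

theorem exists_family_det_gram_dvd_of_isometry {p : ℕ} [hp : Fact p.Prime] {A : Type*}
    [AddCommGroup A] [Module.Free ℤ A] [Module.Finite ℤ A] (β : A →ₗ[ℤ] A →ₗ[ℤ] ℤ)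
    (hanis : ∀ x, β x x = 0 → x = 0) (hunim : Function.Surjective β)
    (σ : End ℤ A) (hσ : ∀ x y, β (σ x) (σ y) = β x y) (hpow : σ ^ p = 1) (hne : σ ≠ 1)
    {d : ℕ} (hrank : finrank ℤ A = d + (p - 1)) (hd : d < p - 1) :
    ∃ e : Fin d → A, (Matrix.of fun i j => β (e i) (e j)).det.natAbs ∣ p := by
  let ψ : End ℤ A := 1 - σ
  let F := LinearMap.ker ψ
  have hF : ∀ x, x ∈ F ↔ σ x = x := fun x => by
    simp only [F, ψ, LinearMap.mem_ker, LinearMap.sub_apply, End.one_apply, sub_eq_zero]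
    exact eq_comm
  let e := finBasis ℤ F
  let φ : A →ₗ[ℤ] (Fin (finrank ℤ F) → ℤ) := LinearMap.pi fun j => β.flip (e j : A)
  have hφ : ∀ x j, φ x j = β x (e j) := fun x j => rfl
  let M := LinearMap.ker φ
  have hM : ∀ x, x ∈ M ↔ ∀ y ∈ F, β x y = 0 := by
    intro x
    constructor
    · intro hx y hy
      have h : (β x) ∘ₗ F.subtype = 0 := by
        refine e.ext fun j => ?_
        exact congrFun (LinearMap.mem_ker.1 hx) j
      exact LinearMap.congr_fun h ⟨y, hy⟩
    · intro hx
      exact funext fun j => hx _ (e j).2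
  have hFM : ∀ x ∈ F, x ∈ M → x = 0 := fun x hx hx' => hanis x ((hM x).1 hx' x hx)
  have hψM : ∀ x, ψ x ∈ M := by
    intro x
    rw [hM]
    intro y hy
    have h := hσ x y
    rw [(hF y).1 hy] at h
    simp [ψ, h]
  have hσM : ∀ x ∈ M, σ x ∈ M := by
    intro x hx
    have h := M.sub_mem hx (hψM x)
    simpa [ψ] using h
  let τ : End ℤ M := σ.restrict hσM
  have hτ : aeval τ (cyclotomic p ℤ) = 0 := by
    ext x
    have hcoe : ((aeval τ (cyclotomic p ℤ) x : M) : A) = aeval σ (cyclotomic p ℤ) (x : A) := by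
      simp only [cyclotomic_prime, map_sum, map_pow, aeval_X, LinearMap.sum_apply]
      rw [AddSubmonoidClass.coe_finsetSum]
      refine Finset.sum_congr rfl fun i _ => ?_
      rw [Module.End.pow_restrict]
      rfl
    rw [LinearMap.zero_apply, ZeroMemClass.coe_zero]
    refine hFM _ ?_ (SetLike.coe_mem _)
    rw [hcoe, LinearMap.mem_ker]
    have h := congrArg (aeval σ) (cyclotomic_prime_mul_X_sub_one ℤ p)
    rw [mul_comm] at h
    simp only [map_mul, map_sub, map_pow, aeval_X, map_one, hpow, sub_self] at h
    have h2 := LinearMap.congr_fun h (x : A)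
    rw [End.mul_apply, LinearMap.zero_apply] at h2
    rw [show ψ = -(σ - 1) from (neg_sub _ _).symm, LinearMap.neg_apply, h2, neg_zero]
  have hφsurj : Function.Surjective φ := by
    intro c
    obtain ⟨s, hs⟩ := ψ.rangeRestrict.exists_rightInverse_of_surjective
      ψ.range_rangeRestrict
    have hs' : ∀ y, ψ (s y) = y := fun y => congrArg Subtype.val (LinearMap.congr_fun hs y)
    let r : A →ₗ[ℤ] F := (LinearMap.id - s ∘ₗ ψ.rangeRestrict).codRestrict F fun x => by
      simp [F, LinearMap.mem_ker, hs']
    have hr : ∀ y : F, r y = y := fun y => by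
      have : ψ.rangeRestrict (y : A) = 0 := Subtype.ext y.2
      ext
      simp [r, this]
    obtain ⟨v, hv⟩ := hunim (e.constr ℤ c ∘ₗ r)
    refine ⟨v, funext fun j => ?_⟩
    rw [hφ, hv, LinearMap.comp_apply, hr, Basis.constr_basis]
  have hsum : finrank ℤ F + finrank ℤ M = finrank ℤ A := by
    have h := M.finrank_quotient_add_finrank
    rwa [(φ.quotKerEquivOfSurjective hφsurj).finrank_eq, finrank_fin_fun] at h
  have hpos : 0 < finrank ℤ M := by
    rw [Module.finrank_pos_iff]
    by_contra hM0
    rw [not_nontrivial_iff_subsingleton] at hM0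
    refine hne (LinearMap.ext fun x => (hF x).1 ?_)
    exact congrArg Subtype.val (Subsingleton.elim (⟨ψ x, hψM x⟩ : M) 0)
  obtain ⟨hMrank, hdet⟩ := finrank_and_det_of_aeval_cyclotomic τ hτ hpos (by omega)
  obtain rfl : finrank ℤ F = d := by omega
  refine ⟨fun j => e j, ?_⟩
  let g : End ℤ (Fin (finrank ℤ F) → ℤ) := φ ∘ₗ F.subtype ∘ₗ e.equivFun.symm.toLinearMap
  have hg : (LinearMap.det g).natAbs
      = (Matrix.of fun i j => β (e i : A) (e j : A)).det.natAbs := by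
    rw [← LinearMap.det_toMatrix', ← Matrix.det_transpose]
    congr 2
    ext i j
    simp [LinearMap.toMatrix'_apply, g, hφ]
  have hginj : Function.Injective g := by
    rw [injective_iff_map_eq_zero]
    intro x hx
    have h := hFM _ (e.equivFun.symm x).2 hx
    exact e.equivFun.symm.map_eq_zero_iff.1 (Subtype.ext h)
  let ψ' : A →ₗ[ℤ] M := ψ.codRestrict M hψM
  have hψ' : ψ' ∘ₗ M.subtype = 1 - τ := rfl
  have hτinj : Function.Injective (1 - τ : End ℤ M) := by
    rw [injective_iff_map_eq_zero]
    intro x hx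
    exact Subtype.ext (hFM _ (congrArg Subtype.val hx) x.2)
  have hcomap : (LinearMap.range g).toAddSubgroup.comap φ.toAddMonoidHom
      = (LinearMap.range (1 - τ)).toAddSubgroup.comap ψ'.toAddMonoidHom := by
    ext x
    constructor
    · rintro ⟨c, hc⟩
      let y : F := e.equivFun.symm c
      have hy : φ (x - y) = 0 := by
        rw [map_sub, sub_eq_zero]
        exact hc.symm
      refine ⟨⟨x - y, hy⟩, Subtype.ext ?_⟩
      change ψ (x - y) = ψ x
      rw [map_sub, LinearMap.mem_ker.1 y.2, sub_zero]
    · rintro ⟨y, hy⟩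
      have hy' : ψ (y : A) = ψ x := congrArg Subtype.val hy
      have hxy : x - y ∈ F := by
        rw [LinearMap.mem_ker, map_sub, hy', sub_self]
      refine ⟨e.equivFun ⟨x - y, hxy⟩, ?_⟩
      change φ (e.equivFun.symm (e.equivFun ⟨x - y, hxy⟩) : F) = φ x
      rw [LinearEquiv.symm_apply_apply, map_sub, LinearMap.mem_ker.1 y.2, sub_zero]
  rw [← hg, ← index_range_eq_natAbs_det g hginj,
    ← AddSubgroup.index_comap_of_surjective _ (f := φ.toAddMonoidHom) hφsurj, hcomap,
    AddSubgroup.index_comap]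
  refine (AddSubgroup.relIndex_dvd_index_of_normal _ _).trans ?_
  rw [index_range_eq_natAbs_det _ hτinj, hdet, Int.natAbs_natCast]

theorem discreteTopology_of_forall_le_inner_self {n : ℕ} (L : Submodule ℤ (Eu n)) {c : ℝ}
    (hc : 0 < c) (hL : ∀ x ∈ L, x ≠ 0 → c ≤ ⟪x, x⟫) : DiscreteTopology L := by
  refine DiscreteTopology.of_forall_le_dist (Real.sqrt_pos.2 hc) fun x y hxy => ?_
  beta_reduce
  rw [Subtype.dist_eq, dist_eq_norm]
  refine Real.sqrt_le_iff.2 ⟨norm_nonneg _, ?_⟩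
  rw [← real_inner_self_eq_norm_sq]
  exact hL _ (L.sub_mem x.2 y.2) (sub_ne_zero.2 fun h => hxy (Subtype.ext h))

theorem exists_bilin_eq_inner_of_dualSet_eq {n : ℕ} (L : Submodule ℤ (Eu n))
    [DiscreteTopology L] [IsZLattice ℝ L] (hL : dualSet (L : Set (Eu n)) = L) :
    ∃ β : L →ₗ[ℤ] L →ₗ[ℤ] ℤ, (∀ x y : L, (β x y : ℝ) = ⟪(x : Eu n), (y : Eu n)⟫) ∧
      Function.Surjective β := by
  have hint : ∀ x y : L, ∃ k : ℤ, ⟪(x : Eu n), (y : Eu n)⟫ = (k : ℝ) := fun x y => by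
    have hx : (x : Eu n) ∈ dualSet (L : Set (Eu n)) := hL.ge x.2
    exact hx y y.2
  choose f hf using hint
  let β : L →ₗ[ℤ] L →ₗ[ℤ] ℤ := LinearMap.mk₂ ℤ f
    (fun x x' y => by
      apply Int.cast_injective (α := ℝ)
      rw [Int.cast_add, ← hf, ← hf, ← hf, Submodule.coe_add, inner_add_left])
    (fun c x y => by
      apply Int.cast_injective (α := ℝ)
      rw [smul_eq_mul, Int.cast_mul, ← hf, ← hf, Submodule.coe_smul, ← Int.cast_smul_eq_zsmul ℝ,
        real_inner_smul_left])
    (fun x y y' => by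
      apply Int.cast_injective (α := ℝ)
      rw [Int.cast_add, ← hf, ← hf, ← hf, Submodule.coe_add, inner_add_right])
    (fun c x y => by
      apply Int.cast_injective (α := ℝ)
      rw [smul_eq_mul, Int.cast_mul, ← hf, ← hf, Submodule.coe_smul, ← Int.cast_smul_eq_zsmul ℝ,
        real_inner_smul_right])
  have hβ : ∀ x y : L, (β x y : ℝ) = ⟪(x : Eu n), (y : Eu n)⟫ := fun x y => (hf x y).symm
  refine ⟨β, hβ, fun h => ?_⟩
  let b := Module.Free.chooseBasis ℤ L
  let B := b.ofZLatticeBasis ℝ L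
  let l : Eu n →ₗ[ℝ] ℝ := B.constr ℝ fun i => (h (b i) : ℝ)
  let v : Eu n := (InnerProductSpace.toDual ℝ (Eu n)).symm l.toContinuousLinearMap
  have hv : ∀ y : L, ⟪v, (y : Eu n)⟫ = (h y : ℝ) := by
    intro y
    have hl : l.restrictScalars ℤ ∘ₗ L.subtype = (Int.castAddHom ℝ).toIntLinearMap ∘ₗ h := by
      refine b.ext fun i => ?_
      change l (b i) = (h (b i) : ℝ)
      rw [← b.ofZLatticeBasis_apply ℝ L i]
      exact B.constr_basis ℝ _ i
    rw [InnerProductSpace.toDual_symm_apply]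
    exact LinearMap.congr_fun hl y
  have hvL : v ∈ L := by
    rw [← SetLike.mem_coe, ← hL]
    exact fun y hy => ⟨h ⟨y, hy⟩, hv ⟨y, hy⟩⟩
  refine ⟨⟨v, hvL⟩, LinearMap.ext fun y => ?_⟩
  apply Int.cast_injective (α := ℝ)
  rw [hβ, ← hv]

theorem linearIndependent_of_det_ne_zero {V : Type*} [NormedAddCommGroup V]
    [InnerProductSpace ℝ V] {ι : Type*} [Fintype ι] [DecidableEq ι] {v : ι → V}
    (h : (Matrix.of fun i j => ⟪v i, v j⟫).det ≠ 0) : LinearIndependent ℝ v := by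
  rw [Fintype.linearIndependent_iff]
  intro c hc
  have hmul : (Matrix.of fun i j => ⟪v i, v j⟫).mulVec c = 0 := by
    ext i
    have h0 : ⟪v i, ∑ j, c j • v j⟫ = 0 := by rw [hc, inner_zero_right]
    simpa [Matrix.mulVec, dotProduct, inner_sum, real_inner_smul_right, mul_comm] using h0
  exact congrFun (Matrix.eq_zero_of_mulVec_eq_zero h hmul)

theorem exists_short_vector_of_det_gram_le {V : Type*} [NormedAddCommGroup V]
    [InnerProductSpace ℝ V] {v : Fin 12 → V} {G : Matrix (Fin 12) (Fin 12) ℤ}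
    (hG : ∀ i j, (G i j : ℝ) = ⟪v i, v j⟫) (h0 : G.det ≠ 0) (hdet : G.det ≤ 37) :
    ∃ x ∈ Submodule.span ℤ (Set.range v), x ≠ 0 ∧ ⟪x, x⟫ < 6 := by
  have hli : LinearIndependent ℝ v := by
    apply linearIndependent_of_det_ne_zero
    have : (Matrix.of fun i j => ⟪v i, v j⟫) = G.map (Int.castRingHom ℝ) := by
      ext i j
      simp [hG]
    rw [this, ← RingHom.mapMatrix_apply, ← RingHom.map_det]
    simpa using h0
  let W := Submodule.span ℝ (Set.range v)
  have : FiniteDimensional ℝ W := FiniteDimensional.span_of_finite ℝ (Set.finite_range v)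
  let T : W ≃ₗᵢ[ℝ] Eu 12 := (stdOrthonormalBasis ℝ W).repr.trans
    (LinearIsometryEquiv.piLpCongrLeft 2 ℝ ℝ (finCongr (by
      rw [finrank_span_eq_card hli, Fintype.card_fin])))
  let S : Eu 12 →ₗᵢ[ℝ] V := W.subtypeₗᵢ.comp T.symm.toLinearIsometry
  let b : Fin 12 → Eu 12 := fun i => T ⟨v i, Submodule.subset_span ⟨i, rfl⟩⟩
  have hSb : ∀ i, S (b i) = v i := fun i => by simp [S, b]
  have hb : LinearIndependent ℝ b := by
    refine LinearIndependent.of_comp S.toLinearMap ?_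
    convert hli
    exact funext hSb
  obtain ⟨x, hx, hx0, hlt⟩ := exists_short_lattice_vector hb
    (fun i j => by rw [hG, ← hSb, ← hSb, S.inner_map_map]) hdet
  refine ⟨S x, ?_, ?_, by rwa [S.inner_map_map]⟩
  · have h := Submodule.mem_map_of_mem (f := S.toLinearMap.restrictScalars ℤ) hx
    rw [Submodule.map_span, ← Set.range_comp] at h
    rwa [show S.toLinearMap.restrictScalars ℤ ∘ b = v from funext hSb] at h
  · exact fun h => hx0 (S.injective (h.trans S.map_zero.symm))

/-- STATEMENT: There is no positive definite lattice of rank 12 with minimum ≥ 6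
and determinant dividing 37; consequently an extremal even unimodular lattice of
dimension 48 has no automorphism of order 37. -/
theorem stmt8 :
    (¬ ∃ b : Fin 12 → Eu 12, LinearIndependent ℝ b ∧
      (∃ G : Matrix (Fin 12) (Fin 12) ℤ,
        (∀ i j, (G i j : ℝ) = ⟪b i, b j⟫) ∧  G.det ∣ 37) ∧
      (∀ x ∈ Submodule.span ℤ (Set.range b), x ≠ 0 → 6 ≤ ⟪x, x⟫)) ∧
    (∀ L : Submodule ℤ (Eu 48), IsExtremal48 L →
      ∀ σ : Eu 48 ≃ₗ[ℝ] Eu 48, IsAutoOf σ L → orderOf σ ≠ 37) := by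
  refine ⟨?_, ?_⟩
  · rintro ⟨b, hb, ⟨G, hG, hdvd⟩, hmin⟩
    obtain ⟨x, hx, hx0, hlt⟩ :=
      exists_short_lattice_vector hb hG (Int.le_of_dvd (by norm_num) hdvd)
    exact absurd (hmin x hx hx0) (not_le.2 hlt)
  · rintro L ⟨hspan, -, hdual, hmin, -⟩ σ ⟨hiso, himg⟩ hord
    have : Fact (Nat.Prime 37) := ⟨by norm_num⟩
    have : DiscreteTopology L := discreteTopology_of_forall_le_inner_self L (by norm_num) hmin
    have : IsZLattice ℝ L := ⟨hspan⟩
    have hrank : finrank ℤ L = 12 + (37 - 1) := by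
      rw [ZLattice.rank ℝ L, finrank_euclideanSpace_fin]
    obtain ⟨β, hβ, hunim⟩ := exists_bilin_eq_inner_of_dualSet_eq L hdual
    have hσL : ∀ x ∈ L, σ x ∈ L := fun x hx =>
      himg.subset (Set.mem_image_of_mem σ hx)
    let τ : End ℤ L := (σ.toLinearMap.restrictScalars ℤ).restrict hσL
    have hτ : ∀ (k : ℕ) (x : L), (((τ ^ k) x : L) : Eu 48) = (σ ^ k) x := by
      intro k
      induction k with
      | zero => exact fun x => rfl
      | succ k ih =>
        intro x
        rw [pow_succ, pow_succ, End.mul_apply, ih]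
        rfl
    have hτiso : ∀ x y, β (τ x) (τ y) = β x y := fun x y => by
      apply Int.cast_injective (α := ℝ)
      rw [hβ, hβ]
      exact hiso x y
    have hτpow : τ ^ 37 = 1 := by
      ext1 x
      refine Subtype.ext ?_
      rw [hτ, ← hord, pow_orderOf_eq_one]
      rfl
    have hτne : τ ≠ 1 := by
      intro h
      have hσ : σ.toLinearMap = LinearMap.id := LinearMap.ext_on hspan fun x hx =>
        congrArg Subtype.val (LinearMap.congr_fun h ⟨x, hx⟩)
      have hσ1 : σ = 1 := LinearEquiv.toLinearMap_injective hσ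
      rw [hσ1, orderOf_one] at hord
      norm_num at hord
    have hanis : ∀ x, β x x = 0 → x = 0 := fun x hx => by
      have h := hβ x x
      rw [hx, Int.cast_zero] at h
      exact Subtype.ext (inner_self_eq_zero.1 h.symm)
    obtain ⟨e, he⟩ := exists_family_det_gram_dvd_of_isometry β hanis hunim τ hτiso hτpow hτne
      hrank (by norm_num)
    have hdvd := Int.natAbs_dvd_natAbs (b := 37) |>.1 he
    obtain ⟨x, hx, hx0, hlt⟩ := exists_short_vector_of_det_gram_le (v := fun i => (e i : Eu 48))
      (fun i j => hβ (e i) (e j)) (ne_zero_of_dvd_ne_zero (by norm_num) hdvd)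
      (Int.le_of_dvd (by norm_num) hdvd)
    have hxL : x ∈ L := by
      refine Submodule.span_le.2 ?_ hx
      rintro _ ⟨i, rfl⟩
      exact (e i).2
    exact absurd (hmin x hxL hx0) (not_le.2 hlt)
end
end
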